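/- (Lemma 1) For all x > 0 and real τ, the kernel Φ_τ(x) = (√π / cosh(πτ)) · Re[J_{iτ}(√x)²] has the representation Φ_τ(x) = −(1/√π) · ∂/∂x ∫_0^∞ [√x · cos(τu)/cosh(u/2)] · L_1(2i√x · cosh(u/2)) du, where L_1 is the modified Struve function of index one. -/

import Mathlib

open Complex MeasureTheory Real Set

/-- Bessel function of the first kind, defined by its power series. -/
noncomputable def besselJ (ν z : ℂ) : ℂ :=
  ∑' k : ℕ, ((-1 : ℂ) ^ k * (z / 2) ^ (2 * (k : ℂ) + ν)) /
    ((k.factorial : ℂ) * Complex.Gamma ((k : ℂ) + ν + 1))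

/-- The kernel `Φ_τ(x) = (√π / cosh(πτ)) · Re[J_{iτ}(√x)²]`. -/
noncomputable def Phi (τ x : ℝ) : ℝ :=
  (Real.sqrt π / Real.cosh (π * τ)) * ((besselJ (Complex.I * τ) (Real.sqrt x : ℂ)) ^ 2).re

/-- The modified Struve function of index one,
`L_1(z) = Σ_{k=0}^∞ (z/2)^{2k+2} / (Γ(k+3/2)Γ(k+5/2))`. -/
noncomputable def struveL1 (z : ℂ) : ℂ :=
  ∑' k : ℕ, (z / 2) ^ (2 * k + 2) /
    (Complex.Gamma ((k : ℂ) + 3 / 2) * Complex.Gamma ((k : ℂ) + 5 / 2))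

lemma factorial_mul_choose_eq_eval_descPochhammer (z : ℂ) (n : ℕ) :
    (n.factorial : ℂ) * Ring.choose z n = (descPochhammer ℂ n).eval z := by
  rw [← nsmul_eq_mul, ← Ring.descPochhammer_eq_factorial_smul_choose,
    ← descPochhammer_map (Int.castRingHom ℂ), Polynomial.eval_map,
    ← Polynomial.eval₂_smulOneHom_eq_smeval]
  congr 1
  ext; simp

lemma Gamma_add_nat_add_one_eq_choose_mul {z : ℂ} (hz : 0 < (z + 1).re) (n : ℕ) :
    Complex.Gamma (z + n + 1) =
      Ring.choose (z + n) n * ((n.factorial : ℂ) * Complex.Gamma (z + 1)) := by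
  have h0 : Complex.Gamma (z + 1) ≠ 0 := Complex.Gamma_ne_zero_of_re_pos hz
  have h1 := Complex.Gamma_add_nat_div_Gamma_eq (n := n) (z + 1) (fun k hk => by
    rw [hk] at hz
    simp at hz
    linarith [(Nat.cast_nonneg k : (0:ℝ) ≤ k)])
  have h2 := Ring.factorial_nsmul_multichoose_eq_ascPochhammer (z + 1) n
  rw [Ring.multichoose_eq, Polynomial.ascPochhammer_smeval_eq_eval] at h2
  rw [← h2, div_eq_iff h0, nsmul_eq_mul] at h1
  rw [show z + n + 1 = z + 1 + n by ring, h1, show z + 1 + n - 1 = z + n by ring]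
  ring

lemma sum_neg_one_pow_mul_choose_mul_choose (z : ℂ) (n : ℕ) :
    ∑ k ∈ Finset.range (n + 1), (-1 : ℂ) ^ k * (n.choose k) * Ring.choose (z + k) n =
      (-1) ^ n := by
  have h := congrFun (Polynomial.fwdDiff_iter_degree_eq_factorial (descPochhammer ℂ n)) z
  rw [descPochhammer_natDegree, (monic_descPochhammer ℂ n).leadingCoeff,
    fwdDiff_iter_eq_sum_shift] at h
  have hn : (n.factorial : ℂ) ≠ 0 := by exact_mod_cast n.factorial_ne_zero
  apply mul_left_cancel₀ hn
  rw [Finset.mul_sum]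
  have h' : ∑ k ∈ Finset.range (n + 1), (-1 : ℂ) ^ (n - k) * (n.choose k) *
      (n.factorial * Ring.choose (z + k) n) = n.factorial := by
    simpa [factorial_mul_choose_eq_eval_descPochhammer] using h
  calc _ = ∑ k ∈ Finset.range (n + 1), (-1) ^ n * ((-1 : ℂ) ^ (n - k) * (n.choose k) *
      (n.factorial * Ring.choose (z + k) n)) := by
        refine Finset.sum_congr rfl fun k hk => ?_
        have hk' : k ≤ n := by simpa [Nat.lt_succ_iff] using hk
        have : (-1 : ℂ) ^ n * (-1) ^ (n - k) = (-1) ^ k := by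
          rw [← pow_add, show n + (n - k) = 2 * (n - k) + k by omega, pow_add, pow_mul]; simp
        rw [← this]; ring
    _ = _ := by rw [← Finset.mul_sum, h']; ring

lemma norm_choose_le {z : ℂ} {N m n : ℕ} (hz : ‖z‖ ≤ N) (hn : n ≤ m) :
    ‖Ring.choose (z + m) n‖ ≤ ((m + N).choose n : ℝ) := by
  have hn0 : (0 : ℝ) < n.factorial := by exact_mod_cast n.factorial_pos
  refine le_of_mul_le_mul_left ?_ hn0
  calc (n.factorial : ℝ) * ‖Ring.choose (z + m) n‖
      = ‖(n.factorial : ℂ) * Ring.choose (z + m) n‖ := by simp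
    _ = ∏ j ∈ Finset.range n, ‖z + m - j‖ := by
        rw [factorial_mul_choose_eq_eval_descPochhammer, descPochhammer_eval_eq_prod_range,
          norm_prod]
    _ ≤ ∏ j ∈ Finset.range n, ((m + N : ℕ) - j : ℝ) := by
        refine Finset.prod_le_prod (fun _ _ => norm_nonneg _) fun j hj => ?_
        have hj' : j ≤ m := by have := Finset.mem_range.1 hj; omega
        have : z + m - j = z + ((m - j : ℕ) : ℂ) := by push_cast [hj']; ring
        rw [this]
        refine (norm_add_le _ _).trans ?_
        rw [Complex.norm_natCast]
        push_cast [hj']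
        linarith
    _ = _ := by
        rw [← descPochhammer_eval_eq_prod_range, descPochhammer_eval_eq_descFactorial,
          Nat.descFactorial_eq_factorial_mul_choose]
        push_cast; ring

lemma choose_mul_choose_eq {z : ℂ} (hz : 0 < (z + 1).re) (k j : ℕ) :
    Ring.choose (z + 2 * k) k * Ring.choose (z + 2 * k + j) j =
      ((k + j).choose k : ℂ) * Ring.choose (z + (2 * k + j : ℕ)) (k + j) := by
  have hk : 0 < (z + k + 1).re := by
    simp at hz ⊢; linarith [(Nat.cast_nonneg k : (0:ℝ) ≤ k)]
  have h2k : 0 < (z + 2 * k + 1).re := by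
    simp at hz ⊢; linarith [(Nat.cast_nonneg k : (0:ℝ) ≤ k)]
  have h1 := Gamma_add_nat_add_one_eq_choose_mul hk k
  have h2 := Gamma_add_nat_add_one_eq_choose_mul h2k j
  have h3 := Gamma_add_nat_add_one_eq_choose_mul hk (k + j)
  have e1 : z + k + k = z + 2 * k := by ring
  have e3 : z + k + (k + j : ℕ) = z + (2 * k + j : ℕ) := by push_cast; ring
  have e4 : z + (2 * k + j : ℕ) = z + 2 * k + j := by push_cast; ring
  rw [e1] at h1
  rw [e3, e4, h2, h1] at h3
  rw [e4]
  have hc : ((k + j).choose k : ℂ) * (k.factorial * j.factorial) = (k + j).factorial := by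
    have := Nat.add_choose_mul_factorial_mul_factorial k j
    rw [← this, Nat.choose_symm_add]; push_cast; ring
  have hG := Complex.Gamma_ne_zero_of_re_pos hk
  have f1 : (k.factorial : ℂ) ≠ 0 := by exact_mod_cast k.factorial_ne_zero
  have f2 : (j.factorial : ℂ) ≠ 0 := by exact_mod_cast j.factorial_ne_zero
  rw [← hc] at h3
  apply mul_right_cancel₀ (mul_ne_zero (mul_ne_zero f1 f2) hG)
  linear_combination h3

lemma hasSum_choose_mul_pow (z : ℂ) {ρ : ℝ} (h0 : 0 ≤ ρ) (h1 : ρ < 1) :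
    HasSum (fun j : ℕ => Ring.choose (z + j) j * (ρ : ℂ) ^ j) ((1 - ρ : ℂ) ^ (-(z + 1))) := by
  have h := (one_div_one_sub_cpow_hasFPowerSeriesOnBall_zero (z + 1)).hasSum (y := (ρ : ℂ)) (by
    rw [← ENNReal.ofReal_one, Metric.eball_ofReal]
    simpa [abs_of_nonneg h0] using h1)
  simp only [zero_add] at h
  rw [one_div, ← cpow_neg] at h
  have e : ∀ j : ℕ, z + 1 + j - 1 = z + j := fun j => by ring
  simpa [FormalMultilinearSeries.ofScalars, e] using h

set_option maxHeartbeats 1000000 in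
/-- A Lambert-type generating function for the generalised binomial coefficients
`choose (z + 2k) k`. -/
lemma hasSum_choose_two_mul {z : ℂ} (hz : 0 < (z + 1).re) {ρ : ℝ} (h0 : 0 ≤ ρ) (h1 : 8 * ρ < 1) :
    HasSum (fun k : ℕ => (-ρ : ℂ) ^ k * Ring.choose (z + 2 * k) k *
      (1 - ρ : ℂ) ^ (-(z + 2 * k + 1))) (1 / (1 + ρ)) := by
  obtain ⟨N, hN⟩ := exists_nat_ge ‖z‖
  set g : ℕ × ℕ → ℂ := fun q => (-ρ : ℂ) ^ q.1 * Ring.choose (z + 2 * q.1) q.1 *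
    (Ring.choose (z + 2 * q.1 + q.2) q.2 * (ρ : ℂ) ^ q.2) with hg
  have hg' : ∀ q : ℕ × ℕ, g q = (ρ : ℂ) ^ (q.1 + q.2) * ((-1) ^ q.1 *
      ((q.1 + q.2).choose q.1 : ℂ) * Ring.choose (z + (2 * q.1 + q.2 : ℕ)) (q.1 + q.2)) := by
    intro q
    have := choose_mul_choose_eq hz q.1 q.2
    simp only [hg]
    rw [neg_pow, pow_add]
    linear_combination (-1 : ℂ) ^ q.1 * (ρ : ℂ) ^ q.1 * (ρ : ℂ) ^ q.2 * this
  have hs : Summable g := by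
    have hgeo := summable_geometric_of_lt_one (r := 8 * ρ) (by positivity) h1
    refine Summable.of_norm_bounded
      (g := fun q : ℕ × ℕ => (2 : ℝ) ^ N * ((8 * ρ) ^ q.1 * (8 * ρ) ^ q.2))
      ((hgeo.mul_of_nonneg hgeo (fun _ => by positivity) (fun _ => by positivity)).mul_left _) ?_
    rintro ⟨k, j⟩
    rw [hg']
    have b1 := norm_choose_le (m := 2 * k + j) (n := k + j) hN (by omega)
    have b2 : (((2 * k + j + N).choose (k + j) : ℕ) : ℝ) ≤ 2 ^ (2 * (k + j) + N) := by
      refine le_trans (b := (2 : ℝ) ^ (2 * k + j + N)) ?_ (pow_le_pow_right₀ (by norm_num) (by omega))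
      exact_mod_cast Nat.choose_le_two_pow _ _
    have b3 : (((k + j).choose k : ℕ) : ℝ) ≤ 2 ^ (k + j) := by
      exact_mod_cast Nat.choose_le_two_pow _ _
    simp only [norm_mul, norm_pow, norm_neg, norm_one, one_pow, one_mul, Complex.norm_real,
      Complex.norm_natCast, Real.norm_eq_abs, abs_of_nonneg h0]
    calc _ ≤ ρ ^ (k + j) * (2 ^ (k + j) * 2 ^ (2 * (k + j) + N)) := by
          gcongr
          exact b1.trans b2
      _ = _ := by
          rw [← pow_add (8 * ρ), mul_pow, show (8 : ℝ) = 2 * 2 ^ 2 by norm_num, mul_pow,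
            ← pow_mul, pow_add 2 (2 * (k + j))]
          ring
  have hv : HasSum g (1 / (1 + ρ)) := by
    rw [← Finset.HasAntidiagonal.sigmaAntidiagonalEquivProd.hasSum_iff]
    have hs' := Finset.HasAntidiagonal.sigmaAntidiagonalEquivProd.summable_iff.2 hs
    have hρ : ‖(-ρ : ℂ)‖ < 1 := by simp [abs_of_nonneg h0]; linarith
    have hgeo := hasSum_geometric_of_norm_lt_one hρ
    rw [sub_neg_eq_add, ← one_div] at hgeo
    have hfib : ∀ n : ℕ, HasSum (fun c : Finset.HasAntidiagonal.antidiagonal n =>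
        (g ∘ Finset.HasAntidiagonal.sigmaAntidiagonalEquivProd) ⟨n, c⟩) ((-ρ : ℂ) ^ n) := by
      intro n
      convert hasSum_fintype _ using 1
      simp only [Function.comp, Finset.HasAntidiagonal.sigmaAntidiagonalEquivProd_apply]
      rw [Finset.sum_coe_sort (Finset.HasAntidiagonal.antidiagonal n) g,
        Finset.Nat.sum_antidiagonal_eq_sum_range_succ_mk, neg_pow,
        ← sum_neg_one_pow_mul_choose_mul_choose (z + n) n, Finset.sum_mul]
      refine Finset.sum_congr rfl fun k hk => ?_
      have hk' : k ≤ n := by simpa [Nat.lt_succ_iff] using hk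
      rw [hg', Nat.add_sub_cancel' hk', show z + n + k = z + (2 * k + (n - k) : ℕ) by
        push_cast [hk']; ring]
      ring
    have := hs'.hasSum.sigma hfib
    exact (this.unique hgeo) ▸ hs'.hasSum
  exact hv.prod_fiberwise fun k =>
    (hasSum_choose_mul_pow (z + 2 * k) h0 (by linarith)).mul_left _

lemma eq_zero_of_forall_integral_exp_neg_nat_mul_eq_zero {h : ℝ → ℝ} (hc : Continuous h)
    (hi : IntegrableOn h (Ioi 0)) (ht : Filter.Tendsto h Filter.atTop (nhds 0))
    (h0 : ∀ n : ℕ, ∫ t in Ioi (0 : ℝ), rexp (-(n * t)) * h t = 0) {t : ℝ} (ht0 : 0 ≤ t) :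
    h t = 0 := by
  set φ : ℝ → ℝ := fun x => if x ≤ 0 then 0 else h (-Real.log x) with hφ
  have hφc : Continuous φ := by
    rw [continuous_iff_continuousAt]
    intro x
    rcases lt_trichotomy x 0 with hx | hx | hx
    · refine continuousAt_const.congr (f := fun _ => (0 : ℝ)) ?_
      filter_upwards [Iio_mem_nhds hx] with y hy
      simp [hφ, le_of_lt (mem_Iio.1 hy)]
    · subst hx
      have h1 : Filter.Tendsto (fun x => h (-Real.log x)) (nhdsWithin 0 (Ioi 0)) (nhds 0) :=
        ht.comp (Filter.tendsto_neg_atBot_atTop.comp Real.tendsto_log_nhdsGT_zero)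
      rw [continuousAt_iff_continuous_left'_right']
      refine ⟨?_, ?_⟩
      · refine ContinuousWithinAt.congr (f := fun _ => (0 : ℝ)) continuousWithinAt_const ?_ ?_
        · intro y hy; simp [hφ, le_of_lt (mem_Iio.1 hy)]
        · simp [hφ]
      · have : φ 0 = 0 := by simp [hφ]
        rw [ContinuousWithinAt, this]
        refine h1.congr' ?_
        filter_upwards [self_mem_nhdsWithin] with y hy
        simp [hφ, not_le.2 (mem_Ioi.1 hy)]
    · refine ContinuousAt.congr (f := fun x => h (-Real.log x)) ?_ ?_
      · exact hc.continuousAt.comp (Real.continuousAt_log hx.ne').neg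
      · filter_upwards [Ioi_mem_nhds hx] with y hy
        simp [hφ, not_le.2 (mem_Ioi.1 hy)]
  have hφe : ∀ t, φ (rexp (-t)) = h t := fun t => by
    simp [hφ, not_le.2 (Real.exp_pos _)]
  have hpoly : ∀ P : Polynomial ℝ, Integrable (fun t => P.eval (rexp (-t)) * h t)
      (volume.restrict (Ioi 0)) ∧ ∫ t in Ioi (0 : ℝ), P.eval (rexp (-t)) * h t = 0 := by
    intro P
    induction P using Polynomial.induction_on' with
    | add p q hp hq =>
      simp only [Polynomial.eval_add, add_mul]
      exact ⟨hp.1.add hq.1, by rw [integral_add hp.1 hq.1, hp.2, hq.2, add_zero]⟩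
    | monomial n a =>
      simp only [Polynomial.eval_monomial, mul_assoc]
      have e : ∀ t : ℝ, rexp (-t) ^ n = rexp (-(n * t)) := fun t => by
        rw [← Real.exp_nat_mul]; congr 1; ring
      simp only [e]
      refine ⟨Integrable.const_mul ?_ _, by rw [integral_const_mul, h0, mul_zero]⟩
      refine Integrable.mono (show Integrable h (volume.restrict (Ioi 0)) from hi) (by fun_prop) ?_
      filter_upwards [ae_restrict_mem measurableSet_Ioi] with t ht
      rw [norm_mul, Real.norm_eq_abs, Real.abs_exp]
      refine mul_le_of_le_one_left (norm_nonneg _) (Real.exp_le_one_iff.2 ?_)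
      have : 0 ≤ (n : ℝ) * t := mul_nonneg n.cast_nonneg (le_of_lt ht)
      linarith
  obtain ⟨C, hC⟩ : ∃ C, ∀ x ∈ Icc (0 : ℝ) 1, ‖φ x‖ ≤ C :=
    isCompact_Icc.exists_bound_of_continuousOn hφc.continuousOn
  have hexp : ∀ t ∈ Ioi (0 : ℝ), rexp (-t) ∈ Icc (0 : ℝ) 1 := fun t ht =>
    ⟨(Real.exp_pos _).le, Real.exp_le_one_iff.2 (by linarith [mem_Ioi.1 ht])⟩
  have hsqi : Integrable (fun t => h t * h t) (volume.restrict (Ioi 0)) := by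
    refine (hi.norm.const_mul C).mono (by fun_prop) ?_
    filter_upwards [ae_restrict_mem measurableSet_Ioi] with t ht
    rw [norm_mul, norm_mul, norm_norm]
    gcongr
    rw [← hφe t]
    exact (hC _ (hexp t ht)).trans (le_abs_self C)
  have hsq : ∫ t in Ioi (0 : ℝ), h t * h t = 0 := by
    set A := ∫ t in Ioi (0 : ℝ), ‖h t‖ with hA
    have hA0 : 0 ≤ A := integral_nonneg fun _ => norm_nonneg _
    rw [← norm_eq_zero]
    refine le_antisymm (le_of_forall_pos_le_add fun ε hε => ?_) (norm_nonneg _)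
    obtain ⟨P, hP⟩ := exists_polynomial_near_of_continuousOn 0 1 φ hφc.continuousOn
      (ε / (A + 1)) (by positivity)
    calc ‖∫ t in Ioi (0 : ℝ), h t * h t‖
        = ‖∫ t in Ioi (0 : ℝ), (h t * h t - P.eval (rexp (-t)) * h t)‖ := by
          rw [integral_sub hsqi (hpoly P).1, (hpoly P).2, sub_zero]
      _ ≤ ∫ t in Ioi (0 : ℝ), ε / (A + 1) * ‖h t‖ := by
          refine norm_integral_le_of_norm_le (hi.norm.const_mul _) ?_
          filter_upwards [ae_restrict_mem measurableSet_Ioi] with t ht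
          rw [← sub_mul, norm_mul]
          gcongr
          rw [← hφe t, norm_sub_rev]
          exact (hP _ (hexp t ht)).le
      _ = ε * (A / (A + 1)) := by rw [integral_const_mul, ← hA]; ring
      _ ≤ 0 + ε := by
          rw [zero_add]
          exact mul_le_of_le_one_right hε.le (by rw [div_le_one (by positivity)]; linarith)
  have hae : (fun t => h t * h t) =ᵐ[volume.restrict (Ioi 0)] 0 :=
    (integral_eq_zero_iff_of_nonneg (fun t => mul_self_nonneg _) hsqi).1 hsq
  have hon : EqOn (fun t => h t * h t) 0 (Ioi 0) :=
    Measure.eqOn_open_of_ae_eq hae isOpen_Ioi (by fun_prop) continuousOn_const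
  have hcl := hon.closure (by fun_prop) continuous_const
  rw [closure_Ioi] at hcl
  exact mul_self_eq_zero.1 (hcl ht0)

lemma integral_exp_I_mul_div_cosh_half (τ : ℝ) :
    ∫ u : ℝ, cexp (I * τ * u) / (2 * Real.cosh (u / 2) : ℝ) = π / Real.cosh (π * τ) := by
  set s : ℂ := 1 / 2 + I * τ with hs
  have hs0 : 0 < s.re := by simp [hs]
  have hs1 : 0 < (1 - s).re := by simp [hs]; norm_num
  have hB := Complex.betaIntegral_eq_Gamma_mul_div s (1 - s) hs0 hs1
  rw [add_sub_cancel, Complex.Gamma_one, div_one, Complex.Gamma_mul_Gamma_one_sub,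
    Complex.betaIntegral, intervalIntegral.integral_of_le zero_le_one,
    integral_Ioc_eq_integral_Ioo, ← Real.range_sigmoid, ← image_univ,
    integral_image_eq_integral_abs_deriv_smul MeasurableSet.univ
      (fun t _ => (Real.hasDerivAt_sigmoid t).hasDerivWithinAt)
      (Real.sigmoid_injective.injOn), setIntegral_univ] at hB
  have hsin : Complex.sin (π * s) = Real.cosh (π * τ) := by
    rw [hs, show (π : ℂ) * (1 / 2 + I * τ) = (π * τ : ℂ) * I + π / 2 by ring,
      Complex.sin_add_pi_div_two, Complex.cos_mul_I]
    push_cast; rfl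
  rw [hsin] at hB
  rw [← hB]
  congr 1
  ext t
  have hσ := Real.sigmoid_pos t
  have hσ1 := Real.sigmoid_lt_one t
  have h1 : 1 - Real.sigmoid t = Real.sigmoid t * rexp (-t) := by
    rw [Real.sigmoid_mul_rexp_neg, Real.sigmoid_neg]
  have hσ0 : (Real.sigmoid t : ℂ) ≠ 0 := by exact_mod_cast hσ.ne'
  rw [abs_of_pos (mul_pos hσ (by linarith)), show ((1 : ℂ) - (Real.sigmoid t : ℂ)) =
    ((1 - Real.sigmoid t : ℝ) : ℂ) by push_cast; rfl, h1, real_smul]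
  push_cast
  rw [show (1 : ℂ) - s - 1 = -s by ring, show cexp (-(t : ℂ)) = ((rexp (-t) : ℝ) : ℂ) by push_cast; rfl,
    Complex.mul_cpow_ofReal_nonneg hσ.le (Real.exp_pos _).le, Complex.cpow_neg,
    Complex.cpow_sub _ _ hσ0, Complex.cpow_one]
  have hσs : (Real.sigmoid t : ℂ) ^ s ≠ 0 := by
    rw [Complex.cpow_ne_zero_iff]; exact Or.inl hσ0
  have h2 : ((rexp (-t) : ℝ) : ℂ) ^ (-s) = cexp (t * s) := by
    rw [Complex.cpow_def_of_ne_zero (by exact_mod_cast (Real.exp_pos _).ne'),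
      ← Complex.ofReal_log (Real.exp_pos _).le, Real.log_exp]
    congr 1; push_cast; ring
  rw [h2]
  have h3 : (Real.sigmoid t : ℂ) * (rexp (-t) : ℝ) * cexp (t / 2) = 1 / (2 * Real.cosh (t / 2) : ℝ) := by
    rw [show cexp (t / 2) = (rexp (t / 2) : ℝ) by push_cast; rfl]
    norm_cast
    rw [Real.sigmoid_def, Real.cosh_eq]
    have e1 : rexp (-t) = rexp (-(t/2)) * rexp (-(t/2)) := by rw [← Real.exp_add]; congr 1; ring
    have e2 : rexp (t / 2) * rexp (-(t/2)) = 1 := by rw [← Real.exp_add]; simp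
    rw [e1]
    have p1 := Real.exp_pos (t / 2)
    have p2 := Real.exp_pos (-(t / 2))
    generalize rexp (t / 2) = E at *
    generalize rexp (-(t / 2)) = E' at *
    field_simp
    linear_combination (E * E' + 1 + E' ^ 2) * e2
  have h4 : cexp (t * s) = cexp (t / 2) * cexp (I * τ * t) := by
    rw [← Complex.exp_add]; congr 1; rw [hs]; ring
  have h5 : 1 / (2 * Complex.cosh (t / 2)) = (Real.sigmoid t : ℂ) * (rexp (-t) : ℝ) * cexp (t / 2) := by
    rw [h3]; push_cast; rfl
  rw [h4, div_eq_mul_inv, ← one_div, h5]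
  field_simp

lemma integrable_inv_cosh_half : Integrable (fun u : ℝ => (Real.cosh (u / 2))⁻¹) := by
  have h := integral_exp_I_mul_div_cosh_half 0
  have h' : Integrable (fun u : ℝ => cexp (I * (0 : ℝ) * u) / (2 * Real.cosh (u / 2) : ℝ)) := by
    refine Integrable.of_integral_ne_zero ?_
    rw [h]; simp [Real.pi_ne_zero]
  have h2 := (h'.re).const_mul 2
  refine h2.congr (Filter.Eventually.of_forall fun u => ?_)
  have := (Real.cosh_pos (u / 2)).ne'
  simp only [ofReal_zero, mul_zero, zero_mul, Complex.exp_zero]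
  rw [RCLike.re_eq_complex_re, Complex.div_ofReal_re, Complex.one_re]
  field_simp

lemma integrable_mul_inv_cosh_half {f : ℝ → ℝ} {C : ℝ} (hf : Measurable f) (hC : ∀ u, |f u| ≤ C) :
    Integrable (fun u : ℝ => f u * (Real.cosh (u / 2))⁻¹) :=
  integrable_inv_cosh_half.bdd_mul hf.aestronglyMeasurable (Filter.Eventually.of_forall hC)

lemma integral_cos_mul_inv_cosh_half (τ : ℝ) :
    ∫ u : ℝ, Real.cos (τ * u) * (Real.cosh (u / 2))⁻¹ = 2 * π / Real.cosh (π * τ) := by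
  have h := integral_exp_I_mul_div_cosh_half τ
  have hi : Integrable (fun u : ℝ => cexp (I * τ * u) / (2 * Real.cosh (u / 2) : ℝ)) := by
    refine Integrable.of_integral_ne_zero ?_
    rw [h]
    have := (Real.cosh_pos (π * τ)).ne'
    exact div_ne_zero (by exact_mod_cast Real.pi_ne_zero) (by exact_mod_cast this)
  have h2 := congrArg Complex.re h
  rw [← ofReal_div, ofReal_re, ← RCLike.re_eq_complex_re, ← integral_re hi] at h2
  rw [mul_div_assoc, ← h2, ← integral_const_mul]
  congr 1
  ext u
  rw [RCLike.re_eq_complex_re, Complex.div_ofReal_re, show I * (τ : ℂ) * u = ((τ * u : ℝ) : ℂ) * I by push_cast; ring,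
    Complex.exp_ofReal_mul_I_re]
  field_simp

lemma integral_cos_mul_cosh_div (τ a : ℝ) :
    ∫ u in Ioi (0 : ℝ), Real.cos (τ * u) *
        (Real.cosh (u / 2) / (Real.sinh a ^ 2 + Real.cosh (u / 2) ^ 2)) =
      π * Real.cos (2 * τ * a) / (Real.cosh a * Real.cosh (π * τ)) := by
  have hca := Real.cosh_pos a
  set g : ℝ → ℝ := fun u => Real.cos (τ * u) *
        (Real.cosh (u / 2) / (Real.sinh a ^ 2 + Real.cosh (u / 2) ^ 2)) with hg
  have hev : ∀ u, g |u| = g u := fun u => by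
    rcases abs_choice u with h | h <;> rw [h]
    simp [hg, neg_div]
  have h1 : ∫ u, g u = 2 * ∫ u in Ioi (0 : ℝ), g u := by
    rw [← integral_comp_abs]; simp only [hev]
  have e : ∀ u, g u = (2 * Real.cosh a)⁻¹ *
      (Real.cos (τ * u) * (Real.cosh ((u + 2 * a) / 2))⁻¹ +
        Real.cos (τ * u) * (Real.cosh ((u - 2 * a) / 2))⁻¹) := fun u => by
    have k1 : (u + 2 * a) / 2 = u / 2 + a := by ring
    have k2 : (u - 2 * a) / 2 = u / 2 - a := by ring
    have p1 := Real.cosh_pos (u / 2 + a)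
    have p2 := Real.cosh_pos (u / 2 - a)
    have p3 := Real.cosh_pos (u / 2)
    have q : Real.sinh a ^ 2 + Real.cosh (u / 2) ^ 2 =
        Real.cosh (u / 2 + a) * Real.cosh (u / 2 - a) := by
      rw [Real.cosh_add, Real.cosh_sub]
      linear_combination (-Real.cosh (u/2)^2) * Real.cosh_sq a - (Real.sinh a)^2 * Real.cosh_sq (u/2)
    have q2 : Real.cosh (u / 2 + a) + Real.cosh (u / 2 - a) = 2 * Real.cosh (u / 2) * Real.cosh a := by
      rw [Real.cosh_add, Real.cosh_sub]; ring
    simp only [hg]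
    rw [k1, k2, q]
    generalize Real.cosh (u / 2 + a) = A at *
    generalize Real.cosh (u / 2 - a) = B at *
    field_simp
    linear_combination (-1 : ℝ) * Real.cos (τ * u) * q2
  have hcs : ∀ b : ℝ, Measurable fun u => Real.cos (τ * (u + b)) := fun b => by fun_prop
  have i1 : ∀ b, Integrable (fun u => Real.cos (τ * (u + b)) * (Real.cosh (u / 2))⁻¹) := fun b =>
    integrable_mul_inv_cosh_half (hcs b) fun u => Real.abs_cos_le_one _
  have j1 : Integrable fun u => Real.cos (τ * u) * (Real.cosh ((u + 2 * a) / 2))⁻¹ := by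
    simpa using (i1 (-(2 * a))).comp_add_right (2 * a)
  have j2 : Integrable fun u => Real.cos (τ * u) * (Real.cosh ((u - 2 * a) / 2))⁻¹ := by
    simpa using (i1 (2 * a)).comp_sub_right (2 * a)
  have s1 : ∫ u, Real.cos (τ * u) * (Real.cosh ((u + 2 * a) / 2))⁻¹ =
      ∫ u, Real.cos (τ * (u + -(2 * a))) * (Real.cosh (u / 2))⁻¹ := by
    have := integral_add_right_eq_self (μ := volume)
      (fun u => Real.cos (τ * (u + -(2 * a))) * (Real.cosh (u / 2))⁻¹) (2 * a)
    simpa using this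
  have s2 : ∫ u, Real.cos (τ * u) * (Real.cosh ((u - 2 * a) / 2))⁻¹ =
      ∫ u, Real.cos (τ * (u + 2 * a)) * (Real.cosh (u / 2))⁻¹ := by
    have := integral_sub_right_eq_self (μ := volume)
      (fun u => Real.cos (τ * (u + 2 * a)) * (Real.cosh (u / 2))⁻¹) (2 * a)
    simpa using this
  have key : ∫ u, g u = (2 * Real.cosh a)⁻¹ *
      (2 * Real.cos (2 * τ * a) * (2 * π / Real.cosh (π * τ))) := by
    simp only [e]
    rw [integral_const_mul, integral_add j1 j2, s1, s2, ← integral_add (i1 _) (i1 _),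
      ← integral_cos_mul_inv_cosh_half, ← integral_const_mul (2 * Real.cos (2 * τ * a))]
    refine congrArg _ (integral_congr_ae (Filter.Eventually.of_forall fun u => ?_))
    dsimp only
    rw [show τ * (u + -(2 * a)) = τ * u - 2 * τ * a by ring,
      show τ * (u + 2 * a) = τ * u + 2 * τ * a by ring, Real.cos_sub, Real.cos_add]
    ring
  have : ∫ u in Ioi (0 : ℝ), g u = (∫ u, g u) / 2 := by rw [h1]; ring
  rw [this, key]
  field_simp

/-- The integral `∫₀^∞ cos (τ u) (1 - cos (q cosh (u / 2))) / cosh (u / 2) du`. -/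
noncomputable def cosKernel (τ q : ℝ) : ℝ :=
  ∫ u in Ioi (0 : ℝ), Real.cos (τ * u) * (1 - Real.cos (q * Real.cosh (u / 2))) *
    (Real.cosh (u / 2))⁻¹

lemma norm_cosKernel_integrand_le (τ q u : ℝ) :
    ‖Real.cos (τ * u) * (1 - Real.cos (q * Real.cosh (u / 2))) * (Real.cosh (u / 2))⁻¹‖ ≤
      2 * (Real.cosh (u / 2))⁻¹ := by
  rw [norm_mul, norm_mul, Real.norm_of_nonneg (inv_pos.2 (Real.cosh_pos _)).le]
  have h0 := inv_pos.2 (Real.cosh_pos (u / 2))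
  have h1 : ‖Real.cos (τ * u)‖ ≤ 1 := Real.abs_cos_le_one _
  have h2 : ‖1 - Real.cos (q * Real.cosh (u / 2))‖ ≤ 2 := by
    rw [Real.norm_of_nonneg] <;>
      linarith [Real.neg_one_le_cos (q * Real.cosh (u / 2)), Real.cos_le_one (q * Real.cosh (u / 2))]
  gcongr
  calc _ ≤ (1 : ℝ) * 2 := by gcongr
    _ = 2 := one_mul 2

lemma continuous_inv_cosh_half : Continuous fun u : ℝ => (Real.cosh (u / 2))⁻¹ :=
  Continuous.inv₀ (by fun_prop) fun u => (Real.cosh_pos (u / 2)).ne'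

lemma continuous_cosKernel_integrand (τ : ℝ) : Continuous fun p : ℝ × ℝ =>
    Real.cos (τ * p.2) * (1 - Real.cos (p.1 * Real.cosh (p.2 / 2))) * (Real.cosh (p.2 / 2))⁻¹ := by
  have := continuous_inv_cosh_half.comp (continuous_snd (X := ℝ) (Y := ℝ))
  refine Continuous.mul (by fun_prop) this

lemma continuous_cosKernel (τ : ℝ) : Continuous (cosKernel τ) := by
  refine continuous_of_dominated (bound := fun u => 2 * (Real.cosh (u / 2))⁻¹) (fun q => ?_)
    (fun q => Filter.Eventually.of_forall fun u => norm_cosKernel_integrand_le τ q u)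
    (integrable_inv_cosh_half.integrableOn.const_mul 2)
    (Filter.Eventually.of_forall fun u => ?_)
  · have := (continuous_cosKernel_integrand τ).comp (show Continuous fun u : ℝ => (q, u) by fun_prop)
    exact this.aestronglyMeasurable
  · have := (continuous_cosKernel_integrand τ).comp (show Continuous fun q : ℝ => (q, u) by fun_prop)
    exact this

lemma norm_cosKernel_le (τ q : ℝ) :
    ‖cosKernel τ q‖ ≤ ∫ u in Ioi (0 : ℝ), 2 * (Real.cosh (u / 2))⁻¹ :=
  norm_integral_le_of_norm_le (integrable_inv_cosh_half.integrableOn.const_mul 2)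
    (Filter.Eventually.of_forall fun u => norm_cosKernel_integrand_le τ q u)

lemma integral_exp_neg_mul_one_sub_cos {P : ℝ} (hP : 0 < P) (c : ℝ) :
    ∫ t in Ioi (0 : ℝ), rexp (-(P * t)) * (1 - Real.cos (2 * t * c)) =
      1 / P - P / (P ^ 2 + 4 * c ^ 2) := by
  have hre : ((-P : ℂ) + (2 * c : ℝ) * I).re < 0 := by simp [hP]
  have hz : ((-P : ℂ) + (2 * c : ℝ) * I) ≠ 0 := fun h => by rw [h] at hre; simp at hre
  have i1 := integrableOn_exp_mul_complex_Ioi hre 0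
  have i0 := integrableOn_exp_mul_Ioi (neg_neg_of_pos hP) 0
  have e1 := integral_exp_mul_complex_Ioi hre 0
  have e0 := integral_exp_mul_Ioi (neg_neg_of_pos hP) 0
  have hr : ∀ t : ℝ, RCLike.re (cexp (((-P : ℂ) + (2 * c : ℝ) * I) * t)) =
      rexp (-(P * t)) * Real.cos (2 * t * c) := fun t => by
    rw [RCLike.re_eq_complex_re, show ((-P : ℂ) + (2 * c : ℝ) * I) * t =
      ((-(P * t) : ℝ) : ℂ) + ((2 * t * c : ℝ) : ℂ) * I by push_cast; ring, Complex.exp_add,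
      ← Complex.ofReal_exp, Complex.re_ofReal_mul, Complex.exp_ofReal_mul_I_re]
  have e2 := congrArg Complex.re e1
  rw [← RCLike.re_eq_complex_re, ← integral_re i1] at e2
  simp only [hr] at e2
  have i2 : IntegrableOn (fun t => rexp (-(P * t)) * Real.cos (2 * t * c)) (Ioi 0) := by
    have := i1.re
    simp only [hr] at this
    exact this
  simp only [neg_mul] at e0 i0
  simp only [mul_sub, mul_one]
  rw [integral_sub i0 i2, e0, e2]
  have h3 : P ^ 2 + 4 * c ^ 2 ≠ 0 := by positivity
  simp [Complex.div_re, normSq_apply]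
  field_simp
  ring

lemma integral_exp_neg_mul_cosKernel (τ : ℝ) {a : ℝ} (ha : 0 < a) :
    ∫ t in Ioi (0 : ℝ), rexp (-(2 * Real.sinh a * t)) * cosKernel τ (2 * t) =
      π * Real.cos (2 * τ * a) / (2 * Real.sinh a * (Real.cosh a * Real.cosh (π * τ))) := by
  have hs : 0 < Real.sinh a := Real.sinh_pos_iff.2 ha
  set P := 2 * Real.sinh a with hP
  have hP0 : 0 < P := by positivity
  have i0 := integrableOn_exp_mul_Ioi (neg_neg_of_pos hP0) 0
  simp only [neg_mul] at i0
  have hi : Integrable (Function.uncurry fun t u => rexp (-(P * t)) *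
      (Real.cos (τ * u) * (1 - Real.cos (2 * t * Real.cosh (u / 2))) * (Real.cosh (u / 2))⁻¹))
      ((volume.restrict (Ioi 0)).prod (volume.restrict (Ioi 0))) := by
    have i0' : Integrable (fun x : ℝ => rexp (-(P * x))) (volume.restrict (Ioi 0)) := i0
    refine (Integrable.mul_prod i0' ((integrable_inv_cosh_half.integrableOn (s := Ioi 0)).const_mul 2)).mono' ?_
      (Filter.Eventually.of_forall fun p => ?_)
    · have := (continuous_cosKernel_integrand τ).comp
        (show Continuous fun p : ℝ × ℝ => (2 * p.1, p.2) by fun_prop)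
      exact (Continuous.mul (by fun_prop) this).aestronglyMeasurable
    · simp only [Function.uncurry]
      rw [norm_mul, Real.norm_of_nonneg (Real.exp_pos _).le]
      have := norm_cosKernel_integrand_le τ (2 * p.1) p.2
      gcongr
  have hl : ∀ t, rexp (-(P * t)) * cosKernel τ (2 * t) = ∫ u in Ioi (0 : ℝ), rexp (-(P * t)) *
      (Real.cos (τ * u) * (1 - Real.cos (2 * t * Real.cosh (u / 2))) * (Real.cosh (u / 2))⁻¹) :=
    fun t => by rw [integral_const_mul]; rfl
  simp only [hl]
  rw [integral_integral_swap hi]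
  have hr : ∀ u, (∫ t in Ioi (0 : ℝ), rexp (-(P * t)) *
      (Real.cos (τ * u) * (1 - Real.cos (2 * t * Real.cosh (u / 2))) * (Real.cosh (u / 2))⁻¹)) =
      P⁻¹ * (Real.cos (τ * u) *
        (Real.cosh (u / 2) / (Real.sinh a ^ 2 + Real.cosh (u / 2) ^ 2))) := fun u => by
    have hc := Real.cosh_pos (u / 2)
    have h := integral_exp_neg_mul_one_sub_cos hP0 (Real.cosh (u / 2))
    calc _ = ∫ t in Ioi (0 : ℝ), (Real.cos (τ * u) * (Real.cosh (u / 2))⁻¹) *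
          (rexp (-(P * t)) * (1 - Real.cos (2 * t * Real.cosh (u / 2)))) := by
            congr 1; ext t; ring
      _ = _ := by
        rw [integral_const_mul, h, hP]
        generalize Real.cosh (u / 2) = c at *
        field_simp
        ring
  simp only [hr]
  rw [integral_const_mul, integral_cos_mul_cosh_div]
  have := Real.cosh_pos a
  have := Real.cosh_pos (π * τ)
  field_simp

lemma factorial_mul_norm_Gamma_le {μ : ℂ} (hμ : μ.re = 0) (k : ℕ) :
    k.factorial * ‖Complex.Gamma (μ + 1)‖ ≤ ‖Complex.Gamma (k + μ + 1)‖ := by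
  induction k with
  | zero => simp
  | succ k ih =>
    have hre : ((k : ℂ) + μ + 1).re = k + 1 := by simp [hμ]
    have hne : (k : ℂ) + μ + 1 ≠ 0 := fun h => by
      rw [h] at hre
      simp at hre
      linarith [(Nat.cast_nonneg k : (0:ℝ) ≤ k)]
    have hn : (k : ℝ) + 1 ≤ ‖(k : ℂ) + μ + 1‖ := by
      rw [← hre]; exact re_le_norm _
    rw [show (((k + 1 : ℕ) : ℂ) + μ + 1) = (k + μ + 1) + 1 by push_cast; ring,
      Complex.Gamma_add_one _ hne, norm_mul, Nat.factorial_succ]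
    push_cast
    rw [mul_assoc]
    gcongr

/-- The coefficients of the primitive of `J_μ (2 t)`. -/
noncomputable def primCoeff (μ : ℂ) (k : ℕ) : ℂ :=
  (-1) ^ k / ((2 * k + μ + 1) * (k.factorial * Complex.Gamma (k + μ + 1)))

/-- The primitive of `J_μ (2 t)` vanishing at `0`. -/
noncomputable def primBessel (μ : ℂ) (t : ℝ) : ℂ :=
  ∑' k : ℕ, primCoeff μ k * (t : ℂ) ^ (2 * k + μ + 1)

lemma norm_primCoeff_mul_factorial_le {μ : ℂ} (hμ : μ.re = 0) (k : ℕ) :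
    ‖primCoeff μ k‖ * (2 * k + 1).factorial ≤ 4 ^ k / ‖Complex.Gamma (μ + 1)‖ := by
  have hG : 0 < ‖Complex.Gamma (μ + 1)‖ :=
    norm_pos_iff.2 (Complex.Gamma_ne_zero_of_re_pos (by simp [hμ]))
  have h1 : (2 * k + 1 : ℝ) ≤ ‖(2 * k + μ + 1 : ℂ)‖ := by
    refine le_trans (le_of_eq ?_) (re_le_norm _)
    simp [hμ]
  have h2 := factorial_mul_norm_Gamma_le hμ k
  have h3 : ((2 * k).choose k : ℝ) ≤ 4 ^ k := by
    have := Nat.choose_le_two_pow (2 * k) k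
    rw [pow_mul] at this
    exact_mod_cast this
  have h4 : ((2 * k + 1).factorial : ℝ) =
      (2 * k + 1) * ((2 * k).choose k * k.factorial * k.factorial) := by
    have := Nat.add_choose_mul_factorial_mul_factorial k k
    rw [← two_mul] at this
    rw [Nat.factorial_succ, ← this]
    push_cast; ring
  have hk : (0 : ℝ) < k.factorial := by exact_mod_cast k.factorial_pos
  rw [primCoeff, norm_div, norm_mul, norm_mul, norm_pow, norm_neg, norm_one, one_pow, Complex.norm_natCast,
    h4, div_mul_eq_mul_div, one_mul]
  have hk2 : (0 : ℝ) < 2 * k + 1 := by positivity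
  calc _ ≤ (2 * k + 1) * ((2 * k).choose k * k.factorial * k.factorial) /
        ((2 * k + 1 : ℝ) * (k.factorial * (k.factorial * ‖Complex.Gamma (μ + 1)‖))) := by gcongr
    _ = (2 * k).choose k / ‖Complex.Gamma (μ + 1)‖ := by field_simp
    _ ≤ _ := by gcongr

lemma norm_primBessel_term {μ : ℂ} (hμ : μ.re = 0) (k : ℕ) {t : ℝ} (ht : 0 ≤ t) :
    ‖primCoeff μ k * (t : ℂ) ^ (2 * k + μ + 1)‖ = ‖primCoeff μ k‖ * t ^ (2 * k + 1) := by
  have hre : ((2 : ℂ) * k + μ + 1).re = ((2 * k + 1 : ℕ) : ℝ) := by simp [hμ]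
  rw [norm_mul]
  rcases ht.eq_or_lt with rfl | ht
  · rw [ofReal_zero, Complex.zero_cpow, norm_zero, zero_pow (by omega)]
    intro h
    rw [h, Complex.zero_re] at hre
    exact absurd hre (by norm_cast)
  · rw [Complex.norm_cpow_eq_rpow_re_of_pos ht, hre, Real.rpow_natCast]

lemma norm_exp_mul_primBessel_term_le {μ : ℂ} (hμ : μ.re = 0) (k : ℕ) {t : ℝ} (ht : 0 ≤ t) :
    ‖(rexp (-(4 * t)) : ℂ) * (primCoeff μ k * (t : ℂ) ^ (2 * k + μ + 1))‖ ≤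
      (1 / 4) ^ k * ‖Complex.Gamma (μ + 1)‖⁻¹ := by
  have h := norm_primCoeff_mul_factorial_le hμ k
  have h2 := Real.pow_div_factorial_le_exp (4 * t) (by positivity) (2 * k + 1)
  have hf : (0 : ℝ) < (2 * k + 1).factorial := by exact_mod_cast (2 * k + 1).factorial_pos
  have hG := norm_nonneg (Complex.Gamma (μ + 1))
  rw [norm_mul, norm_primBessel_term hμ k ht, norm_real, Real.norm_of_nonneg (Real.exp_pos _).le,
    Real.exp_neg]
  calc (rexp (4 * t))⁻¹ * (‖primCoeff μ k‖ * t ^ (2 * k + 1))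
      = (‖primCoeff μ k‖ * (2 * k + 1).factorial) *
        ((4 * t) ^ (2 * k + 1) / (2 * k + 1).factorial * (rexp (4 * t))⁻¹) / 4 ^ (2 * k + 1) := by
        rw [mul_pow]; field_simp
    _ ≤ (4 ^ k / ‖Complex.Gamma (μ + 1)‖) * (rexp (4 * t) * (rexp (4 * t))⁻¹) / 4 ^ (2 * k + 1) := by
        gcongr
    _ = (1 / 4) ^ k * ‖Complex.Gamma (μ + 1)‖⁻¹ * (1 / 4) := by
        rw [mul_inv_cancel₀ (Real.exp_pos _).ne', one_div, inv_pow, pow_succ, pow_mul]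
        rw [show (4 : ℝ) ^ 2 = 4 * 4 by norm_num, mul_pow]
        field_simp
    _ ≤ _ := by
        have : 0 ≤ (1 / 4 : ℝ) ^ k * ‖Complex.Gamma (μ + 1)‖⁻¹ := by positivity
        linarith

lemma summable_quarter_pow (c : ℝ) : Summable fun k : ℕ => (1 / 4 : ℝ) ^ k * c :=
  (summable_geometric_of_lt_one (by norm_num) (by norm_num)).mul_right c

lemma summable_primBessel {μ : ℂ} (hμ : μ.re = 0) {t : ℝ} (ht : 0 ≤ t) :
    Summable fun k : ℕ => primCoeff μ k * (t : ℂ) ^ (2 * k + μ + 1) := by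
  have h := Summable.of_norm_bounded (summable_quarter_pow _)
    fun k => norm_exp_mul_primBessel_term_le hμ k ht
  rwa [summable_mul_left_iff (by exact_mod_cast (Real.exp_pos _).ne')] at h

lemma continuous_exp_mul_primBessel {μ : ℂ} (hμ : μ.re = 0) :
    Continuous fun t : ℝ => (rexp (-(4 * |t|)) : ℂ) * primBessel μ |t| := by
  simp only [primBessel, ← tsum_mul_left]
  refine continuous_tsum (fun k => ?_) (summable_quarter_pow _)
    fun k t => norm_exp_mul_primBessel_term_le hμ k (abs_nonneg t)
  have hre : 0 < ((2 : ℂ) * k + μ + 1).re := by simp [hμ]; positivity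
  have h1 := (Complex.continuous_ofReal_cpow_const hre).comp (continuous_abs (G := ℝ))
  have h2 : Continuous fun t : ℝ => (rexp (-(4 * |t|)) : ℂ) := by fun_prop
  exact h2.mul (continuous_const.mul h1)

lemma norm_exp_mul_primBessel_le {μ : ℂ} (hμ : μ.re = 0) {t : ℝ} (ht : 0 ≤ t) :
    ‖(rexp (-(4 * t)) : ℂ) * primBessel μ t‖ ≤
      ∑' k : ℕ, (1 / 4) ^ k * ‖Complex.Gamma (μ + 1)‖⁻¹ := by
  rw [primBessel, ← tsum_mul_left]
  exact tsum_of_norm_bounded (summable_quarter_pow _).hasSum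
    fun k => norm_exp_mul_primBessel_term_le hμ k ht

lemma integral_exp_neg_mul_primBessel_term {μ : ℂ} (hμ : μ.re = 0) (k : ℕ) {P : ℝ} (hP : 0 < P) :
    ∫ t in Ioi (0 : ℝ), cexp (-(P * t)) * (primCoeff μ k * (t : ℂ) ^ (2 * k + μ + 1)) =
      (-1) ^ k * Ring.choose (μ + 2 * k) k * (P : ℂ) ^ (-(2 * k + μ + 2)) := by
  have hre : 0 < ((2 : ℂ) * k + μ + 2).re := by simp [hμ]; positivity
  have h := Complex.integral_cpow_mul_exp_neg_mul_Ioi hre hP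
  have hz : 0 < ((μ + k) + 1).re := by simp [hμ]; positivity
  have hg := Gamma_add_nat_add_one_eq_choose_mul hz k
  have hne : (2 * k + μ + 1 : ℂ) ≠ 0 := fun h => by
    have := congrArg Complex.re h
    simp [hμ] at this
    linarith [(Nat.cast_nonneg k : (0:ℝ) ≤ k)]
  have hG := Complex.Gamma_ne_zero_of_re_pos hz
  have hf : (k.factorial : ℂ) ≠ 0 := by exact_mod_cast k.factorial_ne_zero
  calc _ = ∫ t in Ioi (0 : ℝ), primCoeff μ k *
        ((t : ℂ) ^ (2 * k + μ + 2 - 1) * cexp (-(P * t))) := by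
        congr 1; ext t
        rw [show (2 * k + μ + 2 - 1 : ℂ) = 2 * k + μ + 1 by ring]; ring
    _ = _ := by
        rw [integral_const_mul, h, show (2 * k + μ + 2 : ℂ) = (2 * k + μ + 1) + 1 by ring,
          Complex.Gamma_add_one _ hne, show (2 * k + μ + 1 : ℂ) = μ + k + k + 1 by ring, hg,
          primCoeff, show (2 * k + μ + 1 : ℂ) = μ + k + k + 1 by ring,
          show (k + μ + 1 : ℂ) = μ + k + 1 by ring, show (μ + 2 * k : ℂ) = μ + k + k by ring,
          one_div, Complex.inv_cpow_ofReal_nonneg hP.le, Complex.cpow_neg]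
        rw [show (2 * k + μ + 1 : ℂ) = μ + k + k + 1 by ring] at hne
        field_simp

lemma hasSum_integral_exp_neg_mul_primBessel {μ : ℂ} (hμ : μ.re = 0) {P : ℝ} (hP : 4 ≤ P) :
    HasSum (fun k : ℕ => (-1) ^ k * Ring.choose (μ + 2 * k) k * (P : ℂ) ^ (-(2 * k + μ + 2)))
      (∫ t in Ioi (0 : ℝ), cexp (-(P * t)) * primBessel μ t) := by
  have hP0 : 0 < P := by linarith
  have hn : ∀ k : ℕ, ∀ t ∈ Ioi (0 : ℝ),
      ‖cexp (-(P * t)) * (primCoeff μ k * (t : ℂ) ^ (2 * k + μ + 1))‖ =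
        ‖primCoeff μ k‖ * (t ^ (((2 * k + 1 : ℕ) : ℝ) + 1 - 1) * rexp (-(P * t))) := fun k t ht => by
    rw [norm_mul, norm_primBessel_term hμ k (le_of_lt ht), show cexp (-(P * t)) =
      (rexp (-(P * t)) : ℝ) by push_cast; rfl, norm_real, Real.norm_of_nonneg (Real.exp_pos _).le,
      add_sub_cancel_right, Real.rpow_natCast]
    ring
  have hi : ∀ k : ℕ, Integrable (fun t : ℝ => cexp (-(P * t)) *
      (primCoeff μ k * (t : ℂ) ^ (2 * k + μ + 1))) (volume.restrict (Ioi 0)) := fun k => by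
    refine Integrable.of_integral_ne_zero ?_
    rw [integral_exp_neg_mul_primBessel_term hμ k hP0]
    have hz : 0 < ((μ + k) + 1).re := by simp [hμ]; positivity
    have hg := Gamma_add_nat_add_one_eq_choose_mul hz k
    have h0 : Complex.Gamma (μ + k + k + 1) ≠ 0 := Complex.Gamma_ne_zero_of_re_pos (by
      simp [hμ]; positivity)
    rw [show (μ + 2 * k : ℂ) = μ + k + k by ring]
    refine mul_ne_zero (mul_ne_zero (by simp) fun h => h0 ?_) ?_
    · rw [hg, h, zero_mul]
    · rw [Complex.cpow_ne_zero_iff]; left; exact_mod_cast hP0.ne'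
  simp only [← integral_exp_neg_mul_primBessel_term hμ _ hP0, primBessel, ← tsum_mul_left]
  refine hasSum_integral_of_summable_integral_norm hi ?_
  refine Summable.of_nonneg_of_le (fun k => integral_nonneg fun t => norm_nonneg _) (fun k => ?_)
    (summable_quarter_pow ‖Complex.Gamma (μ + 1)‖⁻¹)
  have hpos : (0 : ℝ) < ((2 * k + 1 : ℕ) : ℝ) + 1 := by positivity
  have h := norm_primCoeff_mul_factorial_le hμ k
  rw [setIntegral_congr_fun measurableSet_Ioi (hn k), integral_const_mul,
    Real.integral_rpow_mul_exp_neg_mul_Ioi hpos hP0, Real.Gamma_nat_eq_factorial]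
  have h5 : (1 / P) ^ (((2 * k + 1 : ℕ) : ℝ) + 1) ≤ (1 / 4) ^ k * (1 / 4) ^ k := by
    rw [← Nat.cast_succ, Real.rpow_natCast]
    calc (1 / P) ^ (2 * k + 1).succ ≤ (1 / 4) ^ (2 * k + 1).succ := by gcongr
      _ = (1 / 4) ^ k * (1 / 4) ^ k * (1 / 16) := by
        rw [Nat.succ_eq_add_one]; ring
      _ ≤ _ := by
        have : (0 : ℝ) ≤ (1 / 4) ^ k * (1 / 4) ^ k := by positivity
        linarith
  calc _ = (‖primCoeff μ k‖ * (2 * k + 1).factorial) * (1 / P) ^ (((2 * k + 1 : ℕ) : ℝ) + 1) := by ring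
    _ ≤ (4 ^ k / ‖Complex.Gamma (μ + 1)‖) * ((1 / 4) ^ k * (1 / 4) ^ k) := by gcongr
    _ = _ := by
      rw [div_mul_eq_mul_div, ← mul_assoc, ← mul_pow]; norm_num
      rfl

lemma integral_exp_neg_mul_primBessel {μ : ℂ} (hμ : μ.re = 0) {a : ℝ} (ha : 4 ≤ 2 * Real.sinh a) :
    ∫ t in Ioi (0 : ℝ), cexp (-((2 * Real.sinh a : ℝ) * t)) * primBessel μ t =
      cexp (-(a * μ)) / (4 * Real.sinh a * Real.cosh a : ℝ) := by
  set r := rexp (-a) with hr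
  have hr0 : 0 < r := Real.exp_pos _
  set P := 2 * Real.sinh a with hP
  have hP0 : 0 < P := by linarith
  have hPr : P * r = 1 - r ^ 2 := by
    rw [hP, Real.sinh_eq, hr]
    have : rexp a * rexp (-a) = 1 := by rw [← Real.exp_add]; simp
    linear_combination this
  have hc : 2 * Real.cosh a * r = 1 + r ^ 2 := by
    rw [Real.cosh_eq, hr]
    have : rexp a * rexp (-a) = 1 := by rw [← Real.exp_add]; simp
    linear_combination this
  have h8 : 8 * r ^ 2 < 1 := by nlinarith
  have hs := hasSum_choose_two_mul (z := μ) (by simp [hμ]) (sq_nonneg r) h8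
  have hrc : (r : ℂ) ≠ 0 := by exact_mod_cast hr0.ne'
  have hPc : (P : ℂ) ≠ 0 := by exact_mod_cast hP0.ne'
  have ht : ∀ k : ℕ, (-1) ^ k * Ring.choose (μ + 2 * k) k * (P : ℂ) ^ (-(2 * k + μ + 2)) =
      (r : ℂ) ^ (μ + 1) * (P : ℂ)⁻¹ * ((-((r ^ 2 : ℝ) : ℂ)) ^ k * Ring.choose (μ + 2 * k) k *
        (1 - ((r ^ 2 : ℝ) : ℂ)) ^ (-(μ + 2 * k + 1))) := fun k => by
    have h1 : (1 : ℂ) - ((r ^ 2 : ℝ) : ℂ) = (P : ℂ) * (r : ℂ) := by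
      rw [← ofReal_one, ← ofReal_sub, ← hPr, ofReal_mul]
    have h2 : (r : ℂ) ^ (-(μ + 2 * k + 1)) * (r : ℂ) ^ (μ + 1) * (r ^ 2) ^ k = 1 := by
      rw [← pow_mul, ← Complex.cpow_natCast, ← Complex.cpow_add _ _ hrc, ← Complex.cpow_add _ _ hrc]
      rw [show (-(μ + 2 * k + 1) + (μ + 1) + ((2 * k : ℕ) : ℂ)) = 0 by push_cast; ring,
        Complex.cpow_zero]
    have h3 : (P : ℂ) ^ (-(2 * k + μ + 2)) = (P : ℂ)⁻¹ * (P : ℂ) ^ (-(μ + 2 * k + 1)) := by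
      rw [← Complex.cpow_neg_one, ← Complex.cpow_add _ _ hPc]
      congr 1; ring
    rw [h1, Complex.mul_cpow_ofReal_nonneg hP0.le hr0.le, h3, neg_pow]
    push_cast
    linear_combination (-((-1) ^ k * Ring.choose (μ + 2 * k) k * ((P : ℂ)⁻¹ *
      (P : ℂ) ^ (-(μ + 2 * k + 1))))) * h2
  have hs2 := hasSum_integral_exp_neg_mul_primBessel hμ ha
  simp only [ht] at hs2
  rw [hs2.unique (hs.mul_left _), Complex.cpow_add _ _ hrc, Complex.cpow_one,
    show (1 : ℂ) + ((r ^ 2 : ℝ) : ℂ) = ((2 * Real.cosh a * r : ℝ) : ℂ) by rw [hc]; push_cast; rfl]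
  have hrμ : (r : ℂ) ^ μ = cexp (-(a * μ)) := by
    rw [Complex.cpow_def_of_ne_zero hrc, ← Complex.ofReal_log hr0.le, hr, Real.log_exp]
    push_cast; ring_nf
  have hcc : (Real.cosh a : ℂ) ≠ 0 := by exact_mod_cast (Real.cosh_pos a).ne'
  have hsc : (Real.sinh a : ℂ) ≠ 0 := by exact_mod_cast (by linarith : 0 < Real.sinh a).ne'
  rw [hrμ, hP]
  push_cast at hcc hsc ⊢
  field_simp
  ring

/-- The kernel `cosKernel` is, up to a constant, the real part of the primitive of `J_{2iτ} (2 t)`. -/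
lemma cosKernel_two_mul (τ : ℝ) {t : ℝ} (ht : 0 ≤ t) :
    cosKernel τ (2 * t) = 2 * π / Real.cosh (π * τ) * (primBessel (2 * (I * τ)) t).re := by
  set μ : ℂ := 2 * (I * τ) with hμd
  have hμ : μ.re = 0 := by simp [hμd]
  set c : ℝ := 2 * π / Real.cosh (π * τ) with hc
  obtain ⟨C₁, hC₁⟩ : ∃ C, ∀ q, ‖cosKernel τ q‖ ≤ C := ⟨_, norm_cosKernel_le τ⟩
  obtain ⟨C₂, hC₂⟩ : ∃ C, ∀ t : ℝ, 0 ≤ t → ‖(rexp (-(4 * t)) : ℂ) * primBessel μ t‖ ≤ C :=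
    ⟨_, fun t ht => norm_exp_mul_primBessel_le hμ ht⟩
  set g : ℝ → ℝ := fun t => rexp (-(4 * |t|)) * cosKernel τ (2 * |t|) -
    c * ((rexp (-(4 * |t|)) : ℂ) * primBessel μ |t|).re with hg
  have hgc : Continuous g := by
    have h1 := continuous_exp_mul_primBessel hμ
    have h2 := continuous_cosKernel τ
    have h3 := Complex.continuous_re.comp h1
    have h4 : Continuous fun t : ℝ => cosKernel τ (2 * |t|) := h2.comp (by fun_prop)
    have h5 : Continuous fun t : ℝ => rexp (-(4 * |t|)) := by fun_prop
    exact (h5.mul h4).sub (continuous_const.mul h3)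
  have hgb : ∀ t, ‖g t‖ ≤ C₁ + |c| * C₂ := fun t => by
    refine (norm_sub_le _ _).trans (add_le_add ?_ ?_)
    · rw [norm_mul, Real.norm_of_nonneg (Real.exp_pos _).le]
      calc _ ≤ 1 * ‖cosKernel τ (2 * |t|)‖ := by
            gcongr
            exact Real.exp_le_one_iff.2 (by have := abs_nonneg t; linarith)
        _ ≤ C₁ := by rw [one_mul]; exact hC₁ _
    · rw [norm_mul, Real.norm_eq_abs, Real.norm_eq_abs]
      gcongr
      exact (abs_re_le_norm _).trans (hC₂ _ (abs_nonneg t))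
  set h : ℝ → ℝ := fun t => rexp (-t) * g t with hh
  have hhb : ∀ t, ‖h t‖ ≤ rexp (-t) * (C₁ + |c| * C₂) := fun t => by
    rw [hh, norm_mul, Real.norm_of_nonneg (Real.exp_pos _).le]
    exact mul_le_mul_of_nonneg_left (hgb t) (Real.exp_pos _).le
  have hhc : Continuous h := by fun_prop
  have hz : h t = 0 := by
    refine eq_zero_of_forall_integral_exp_neg_nat_mul_eq_zero hhc ?_ ?_ (fun n => ?_) ht
    · refine Integrable.mono' ?_ hhc.aestronglyMeasurable (Filter.Eventually.of_forall hhb)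
      exact (integrableOn_exp_neg_Ioi 0).mul_const _
    · refine squeeze_zero_norm hhb ?_
      rw [← zero_mul (C₁ + |c| * C₂)]
      exact (Real.tendsto_exp_neg_atTop_nhds_zero).mul_const _
    · set a := Real.arsinh ((5 + n) / 2) with ha
      have hsa : 2 * Real.sinh a = 5 + n := by rw [ha, Real.sinh_arsinh]; ring
      have hn : (0 : ℝ) ≤ n := n.cast_nonneg
      have ha0 : 0 < a := by rw [← Real.sinh_pos_iff]; linarith
      have e1 := integral_exp_neg_mul_cosKernel τ ha0
      have e2 := integral_exp_neg_mul_primBessel hμ (a := a) (by linarith)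
      rw [hsa] at e1 e2
      have hi2 : Integrable (fun t : ℝ => cexp (-((5 + n : ℝ) * t)) * primBessel μ t)
          (volume.restrict (Ioi 0)) := by
        refine Integrable.of_integral_ne_zero ?_
        rw [e2]
        have := Real.cosh_pos a
        have := Real.sinh_pos_iff.2 ha0
        refine div_ne_zero (Complex.exp_ne_zero _) ?_
        exact_mod_cast (by positivity : (4 * Real.sinh a * Real.cosh a) ≠ 0)
      have hi1 : Integrable (fun t : ℝ => rexp (-((5 + n) * t)) * cosKernel τ (2 * t))
          (volume.restrict (Ioi 0)) := by
        have k1 := integrableOn_exp_mul_Ioi (show -(5 + n : ℝ) < 0 by linarith) 0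
        have k2 : Continuous fun t : ℝ => cosKernel τ (2 * t) :=
          (continuous_cosKernel τ).comp (by fun_prop)
        have := Integrable.mul_bdd k1 k2.aestronglyMeasurable
          (Filter.Eventually.of_forall fun t => hC₁ (2 * t))
        simpa only [neg_mul] using this
      have e3 := congrArg Complex.re e2
      rw [← RCLike.re_eq_complex_re, ← integral_re hi2, RCLike.re_eq_complex_re,
        Complex.div_ofReal_re] at e3
      have e4 : (cexp (-(a * μ))).re = Real.cos (2 * τ * a) := by
        rw [hμd, show -((a : ℂ) * (2 * (I * τ))) = ((-(2 * τ * a) : ℝ) : ℂ) * I by push_cast; ring,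
          Complex.exp_ofReal_mul_I_re, Real.cos_neg]
      rw [e4] at e3
      have e5 : ∀ t ∈ Ioi (0 : ℝ), rexp (-(n * t)) * h t =
          rexp (-((5 + n) * t)) * cosKernel τ (2 * t) -
          c * RCLike.re (cexp (-((5 + n : ℝ) * t)) * primBessel μ t) := fun t ht => by
        have x1 : rexp (-((5 + n) * t)) = rexp (-(n * t)) * rexp (-t) * rexp (-(4 * t)) := by
          rw [← Real.exp_add, ← Real.exp_add]; congr 1; ring
        have x2 : cexp (-((5 + n : ℝ) * t)) = ((rexp (-((5 + n) * t)) : ℝ) : ℂ) := by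
          push_cast; rfl
        rw [x2, RCLike.re_eq_complex_re, Complex.re_ofReal_mul, x1]
        simp only [hh, hg]
        rw [abs_of_pos ht, Complex.re_ofReal_mul]
        ring
      rw [setIntegral_congr_fun measurableSet_Ioi e5, integral_sub hi1 (hi2.re.const_mul c),
        integral_const_mul, e1]
      simp only [RCLike.re_eq_complex_re]
      rw [e3, hc, ← hsa]
      have := Real.cosh_pos a
      have := Real.sinh_pos_iff.2 ha0
      have := Real.cosh_pos (π * τ)
      field_simp
      ring
  have hg0 : g t = 0 := (mul_eq_zero.1 hz).resolve_left (Real.exp_pos _).ne'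
  simp only [hg, abs_of_nonneg ht, Complex.re_ofReal_mul] at hg0
  have he := (Real.exp_pos (-(4 * t))).ne'
  refine mul_left_cancel₀ he ?_
  linear_combination hg0

lemma ofReal_sqrt_pi_eq_Gamma_half : (√π : ℂ) = Complex.Gamma (1 / 2) := by
  rw [Complex.Gamma_one_half_eq, Real.sqrt_eq_rpow, Complex.ofReal_cpow Real.pi_pos.le]
  norm_num

lemma integrableOn_one_sub_rpow_neg_half :
    IntegrableOn (fun s : ℝ => (1 - s) ^ (-(1 / 2) : ℝ)) (Ioo 0 1) := by
  have h := (intervalIntegral.intervalIntegrable_rpow' (a := 0) (b := 1)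
    (show (-1 : ℝ) < -(1 / 2) by norm_num)).comp_sub_left 1 (by finiteness)
  rw [sub_zero, sub_self] at h
  have h2 := (intervalIntegrable_iff_integrableOn_Ioc_of_le zero_le_one).1 h.symm
  exact h2.mono_set Ioo_subset_Ioc_self

lemma integral_one_sub_rpow_mul_cpow {p : ℂ} (hp : 0 ≤ p.re) :
    ∫ s in Ioo (0 : ℝ) 1, ((((1 - s) ^ (-(1 / 2) : ℝ) : ℝ)) : ℂ) * (s : ℂ) ^ p =
      √π * Complex.Gamma (p + 1) / Complex.Gamma (p + 3 / 2) := by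
  have h := Complex.betaIntegral_eq_Gamma_mul_div (p + 1) (1 / 2) (by simp; linarith) (by norm_num)
  rw [Complex.betaIntegral, intervalIntegral.integral_of_le zero_le_one,
    integral_Ioc_eq_integral_Ioo, ← ofReal_sqrt_pi_eq_Gamma_half,
    show p + 1 + 1 / 2 = p + 3 / 2 by ring] at h
  rw [mul_comm (√π : ℂ), ← h]
  refine setIntegral_congr_fun measurableSet_Ioo fun s hs => ?_
  rw [Complex.ofReal_cpow (by linarith [hs.2]), add_sub_cancel_right, mul_comm]
  push_cast
  norm_num

lemma hasSum_integral_one_sub_rpow_mul {b p : ℕ → ℂ} (hb : Summable fun k => ‖b k‖)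
    (hp : ∀ k, 0 < (p k).re) :
    HasSum (fun k => b k * (√π * Complex.Gamma (p k + 1) / Complex.Gamma (p k + 3 / 2)))
      (∫ s in Ioo (0 : ℝ) 1, ((((1 - s) ^ (-(1 / 2) : ℝ) : ℝ)) : ℂ) *
        ∑' k, b k * (s : ℂ) ^ p k) := by
  have hw0 : ∀ s ∈ Ioo (0 : ℝ) 1, 0 ≤ (1 - s) ^ (-(1 / 2) : ℝ) := fun s hs =>
    Real.rpow_nonneg (by linarith [hs.2]) _
  have hsn : ∀ s ∈ Ioo (0 : ℝ) 1, ∀ k, ‖b k * (s : ℂ) ^ p k‖ ≤ ‖b k‖ := fun s hs k => by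
    rw [norm_mul, Complex.norm_cpow_eq_rpow_re_of_pos hs.1]
    exact mul_le_of_le_one_right (norm_nonneg _) (Real.rpow_le_one hs.1.le hs.2.le (hp k).le)
  simp only [← integral_one_sub_rpow_mul_cpow (hp _).le, ← integral_const_mul]
  refine hasSum_integral_of_dominated_convergence
    (fun k s => ‖b k‖ * (1 - s) ^ (-(1 / 2) : ℝ)) (fun k => ?_) (fun k => ?_) ?_ ?_ ?_
  · have h1 := integrableOn_one_sub_rpow_neg_half.aestronglyMeasurable
    have h2 := (Complex.continuous_ofReal_cpow_const (hp k)).aestronglyMeasurable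
      (μ := volume.restrict (Ioo 0 1))
    exact ((Complex.continuous_ofReal.comp_aestronglyMeasurable h1).mul h2).const_mul _
  · refine (ae_restrict_iff' measurableSet_Ioo).2 (Filter.Eventually.of_forall fun s hs => ?_)
    rw [mul_left_comm, norm_mul, norm_real, Real.norm_of_nonneg (hw0 s hs), mul_comm]
    exact mul_le_mul_of_nonneg_right (hsn s hs k) (hw0 s hs)
  · exact Filter.Eventually.of_forall fun s => hb.mul_right _
  · simp only [tsum_mul_right]
    exact integrableOn_one_sub_rpow_neg_half.const_mul _
  · refine (ae_restrict_iff' measurableSet_Ioo).2 (Filter.Eventually.of_forall fun s hs => ?_)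
    have h3 : Summable fun k => b k * (s : ℂ) ^ p k := hb.of_norm_bounded (hsn s hs)
    simpa only [mul_left_comm] using h3.hasSum.mul_left (((1 - s) ^ (-(1 / 2) : ℝ) : ℝ) : ℂ)

lemma factorial_two_mul_add_two (k : ℕ) : ((2 * k + 2).factorial : ℂ) * √π =
    2 ^ (2 * k + 2) * (Complex.Gamma (k + 3 / 2) * Complex.Gamma (k + 2)) := by
  have h := Complex.Gamma_mul_Gamma_add_half (k + 3 / 2)
  rw [show (k + 3 / 2 + 1 / 2 : ℂ) = k + 2 by ring,
    show (2 * (k + 3 / 2) : ℂ) = ((2 * k + 2 : ℕ) : ℂ) + 1 by push_cast; ring,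
    Complex.Gamma_nat_eq_factorial,
    show (1 - (((2 * k + 2 : ℕ) : ℂ) + 1)) = -((2 * k + 2 : ℕ) : ℂ) by ring,
    Complex.cpow_neg, Complex.cpow_natCast] at h
  rw [h]
  field_simp

lemma struveL1_two_mul_I_mul (w : ℝ) :
    struveL1 (2 * I * w) = ((-(1 / π) * ∫ s in Ioo (0 : ℝ) 1,
      (1 - s) ^ (-(1 / 2) : ℝ) * (1 - Real.cos (2 * w * √s)) : ℝ) : ℂ) := by
  set b : ℕ → ℂ := fun k => -((-1) ^ (k + 1) * (2 * w) ^ (2 * (k + 1)) / (2 * (k + 1)).factorial)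
    with hb
  set p : ℕ → ℂ := fun k => ((k + 1 : ℕ) : ℂ) with hp
  have hbs : Summable fun k => ‖b k‖ := by
    have h := (Real.summable_pow_div_factorial (2 * w)).norm
    have h2 := h.comp_injective (i := fun k : ℕ => 2 * (k + 1)) (fun x y h => by simpa using h)
    refine h2.congr fun k => ?_
    simp [hb]
  have hsum : ∀ s ∈ Ioo (0 : ℝ) 1,
      ∑' k, b k * (s : ℂ) ^ p k = ((1 - Real.cos (2 * w * √s) : ℝ) : ℂ) := fun s hs => by
    have h := Complex.hasSum_cos ((2 * w * √s : ℝ) : ℂ)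
    rw [← hasSum_nat_add_iff' 1] at h
    have h' := h.neg
    have hss : ((√s : ℝ) : ℂ) ^ 2 = s := by rw [← ofReal_pow, Real.sq_sqrt hs.1.le]
    refine Eq.trans (tsum_congr fun k => ?_) (h'.tsum_eq.trans ?_)
    swap
    · simp
    · simp only [hb, hp, Complex.cpow_natCast]
      push_cast
      rw [mul_pow (2 * (w : ℂ)), pow_mul (√s : ℂ), hss]
      ring
  have H := hasSum_integral_one_sub_rpow_mul hbs (p := p) (fun k => by
    simp only [hp, Complex.natCast_re]; positivity)
  have hInt : ∫ s in Ioo (0 : ℝ) 1, ((((1 - s) ^ (-(1 / 2) : ℝ) : ℝ)) : ℂ) *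
        ∑' k, b k * (s : ℂ) ^ p k = ((∫ s in Ioo (0 : ℝ) 1,
      (1 - s) ^ (-(1 / 2) : ℝ) * (1 - Real.cos (2 * w * √s)) : ℝ) : ℂ) := by
    rw [← integral_complex_ofReal]
    refine setIntegral_congr_fun measurableSet_Ioo fun s hs => ?_
    rw [hsum s hs, ofReal_mul]
  rw [hInt] at H
  have H2 := H.mul_left (-(1 / π : ℂ))
  rw [struveL1]
  push_cast at H2 ⊢
  rw [← H2.tsum_eq]
  congr 1
  ext k
  have hf := factorial_two_mul_add_two k
  have h3 : Complex.Gamma (k + 3 / 2) ≠ 0 := Complex.Gamma_ne_zero_of_re_pos (by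
    simp; positivity)
  have h5 : Complex.Gamma (k + 5 / 2) ≠ 0 := Complex.Gamma_ne_zero_of_re_pos (by
    simp; positivity)
  have hn : ((2 * k + 2).factorial : ℂ) ≠ 0 := by exact_mod_cast (2 * k + 2).factorial_ne_zero
  have hpi : (π : ℂ) = √π * √π := by
    rw [← ofReal_mul, Real.mul_self_sqrt Real.pi_pos.le]
  have hpi0 : (√π : ℂ) ≠ 0 := by exact_mod_cast (Real.sqrt_pos.2 Real.pi_pos).ne'
  have hI : I ^ (2 * k + 2) = (-1) ^ (k + 1) := by
    rw [show 2 * k + 2 = 2 * (k + 1) by ring, pow_mul, I_sq]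
  simp only [hb, hp]
  push_cast
  rw [show (k + 1 + 1 : ℂ) = k + 2 by ring, show (k + 1 + 3 / 2 : ℂ) = k + 5 / 2 by ring,
    show 2 * (k + 1) = 2 * k + 2 by ring, show (2 * I * w / 2 : ℂ) = I * w by ring, mul_pow, hI,
    mul_pow, hpi]
  generalize Complex.Gamma (k + 3 / 2) = A at *
  generalize Complex.Gamma (k + 5 / 2) = B at *
  generalize Complex.Gamma (k + 2) = C at *
  field_simp
  linear_combination (w : ℂ) ^ (2 * k + 2) * hf

lemma sqrt_cpow {x : ℝ} (hx : 0 < x) (z : ℂ) : ((√x : ℝ) : ℂ) ^ z = (x : ℂ) ^ (z / 2) := by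
  have h1 : ((√x : ℝ) : ℂ) ≠ 0 := by exact_mod_cast (Real.sqrt_pos.2 hx).ne'
  have h2 : (x : ℂ) ≠ 0 := by exact_mod_cast hx.ne'
  rw [Complex.cpow_def_of_ne_zero h1, Complex.cpow_def_of_ne_zero h2,
    ← Complex.ofReal_log (Real.sqrt_nonneg x), ← Complex.ofReal_log hx.le, Real.log_sqrt hx.le]
  congr 1; push_cast; ring

lemma integral_mul_struveL1 (τ x : ℝ) :
    ∫ u in Ioi (0 : ℝ), ((√x * Real.cos (τ * u) / Real.cosh (u / 2) : ℝ) : ℂ) *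
      struveL1 (2 * I * (√x : ℂ) * (Real.cosh (u / 2) : ℂ)) =
    ((-(√x / π) * ∫ s in Ioo (0 : ℝ) 1,
      (1 - s) ^ (-(1 / 2) : ℝ) * cosKernel τ (2 * (√x * √s)) : ℝ) : ℂ) := by
  have hi : Integrable (Function.uncurry fun u s : ℝ =>
      (Real.cos (τ * u) * (1 - Real.cos (2 * (√x * √s) * Real.cosh (u / 2))) *
        (Real.cosh (u / 2))⁻¹) * (1 - s) ^ (-(1 / 2) : ℝ))
      ((volume.restrict (Ioi 0)).prod (volume.restrict (Ioo 0 1))) := by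
    refine (Integrable.mul_prod ((integrable_inv_cosh_half.integrableOn (s := Ioi 0)).const_mul 2)
      integrableOn_one_sub_rpow_neg_half.norm).mono' ?_ (Filter.Eventually.of_forall fun p => ?_)
    · have h1 := (continuous_cosKernel_integrand τ).comp
        (show Continuous fun p : ℝ × ℝ => (2 * (√x * √p.2), p.1) by fun_prop)
      have h2 : AEStronglyMeasurable (fun p : ℝ × ℝ => (1 - p.2) ^ (-(1 / 2) : ℝ))
          ((volume.restrict (Ioi 0)).prod (volume.restrict (Ioo 0 1))) :=
        integrableOn_one_sub_rpow_neg_half.aestronglyMeasurable.comp_snd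
      exact h1.aestronglyMeasurable.mul h2
    · simp only [Function.uncurry]
      rw [norm_mul]
      exact mul_le_mul_of_nonneg_right (norm_cosKernel_integrand_le _ _ _) (norm_nonneg _)
  have hu : ∀ u : ℝ, ((√x * Real.cos (τ * u) / Real.cosh (u / 2) : ℝ) : ℂ) *
      struveL1 (2 * I * (√x : ℂ) * (Real.cosh (u / 2) : ℂ)) =
      ((-(√x / π) * ∫ s in Ioo (0 : ℝ) 1,
        (Real.cos (τ * u) * (1 - Real.cos (2 * (√x * √s) * Real.cosh (u / 2))) *
        (Real.cosh (u / 2))⁻¹) * (1 - s) ^ (-(1 / 2) : ℝ) : ℝ) : ℂ) := fun u => by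
    rw [mul_assoc (2 * I), ← ofReal_mul, struveL1_two_mul_I_mul, ← ofReal_mul]
    congr 1
    rw [← integral_const_mul, ← integral_const_mul, ← integral_const_mul]
    refine integral_congr_ae (Filter.Eventually.of_forall fun s => ?_)
    dsimp only
    rw [show 2 * (√x * Real.cosh (u / 2)) * √s = 2 * (√x * √s) * Real.cosh (u / 2) by ring]
    field_simp
  simp only [hu]
  rw [integral_complex_ofReal, integral_const_mul, integral_integral_swap hi]
  simp only [integral_mul_const]
  simp only [cosKernel, mul_comm]

lemma norm_primBessel_le {μ : ℂ} (hμ : μ.re = 0) {t : ℝ} (ht : 0 ≤ t) :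
    ‖primBessel μ t‖ ≤ rexp (4 * t) * ∑' k : ℕ, (1 / 4) ^ k * ‖Complex.Gamma (μ + 1)‖⁻¹ := by
  have h := norm_exp_mul_primBessel_le hμ ht
  rw [norm_mul, norm_real, Real.norm_of_nonneg (Real.exp_pos _).le, Real.exp_neg] at h
  exact (inv_mul_le_iff₀ (Real.exp_pos _)).1 h

lemma continuous_primBessel_abs {μ : ℂ} (hμ : μ.re = 0) :
    Continuous fun t : ℝ => primBessel μ |t| := by
  have h : Continuous fun t : ℝ => (rexp (4 * |t|) : ℂ) := by fun_prop
  refine (h.mul (continuous_exp_mul_primBessel hμ)).congr fun t => ?_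
  rw [Pi.mul_apply, ← mul_assoc, ← ofReal_mul, ← Real.exp_add]
  simp

/-- The coefficients of `∫₀¹ (1 - s)^{-1/2} primBessel (2ν) √(x s) ds`. -/
noncomputable def sqCoeff (ν : ℂ) (k : ℕ) : ℂ :=
  (-1) ^ k * Complex.Gamma (k + ν + 1 / 2) /
    (k.factorial * Complex.Gamma (k + 2 * ν + 1) * Complex.Gamma (k + ν + 2))

lemma integral_one_sub_rpow_mul_primBessel {ν : ℂ} (hν : ν.re = 0) {x : ℝ} (hx : 0 < x) :
    2 * √x * ∫ s in Ioo (0 : ℝ) 1, ((((1 - s) ^ (-(1 / 2) : ℝ) : ℝ)) : ℂ) *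
      primBessel (2 * ν) (√x * √s) = √π * ∑' k, sqCoeff ν k * (x : ℂ) ^ (k + ν + 1) := by
  have hμ : (2 * ν).re = 0 := by simp [hν]
  have hsx := Real.sqrt_nonneg x
  have hs1 : ∀ s ∈ Ioo (0 : ℝ) 1, primBessel (2 * ν) (√x * √s) =
      ∑' k : ℕ, (primCoeff (2 * ν) k * (√x : ℂ) ^ (2 * k + 2 * ν + 1)) *
        (s : ℂ) ^ (k + ν + 1 / 2) := fun s hs => by
    rw [primBessel]
    refine tsum_congr fun k => ?_
    rw [ofReal_mul, Complex.mul_cpow_ofReal_nonneg hsx (Real.sqrt_nonneg s), sqrt_cpow hs.1,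
      ← mul_assoc]
    congr 2; ring
  have H := hasSum_integral_one_sub_rpow_mul (p := fun k : ℕ => k + ν + 1 / 2)
    (summable_primBessel hμ hsx).norm (fun k => by simp [hν]; positivity)
  have hInt : ∫ s in Ioo (0 : ℝ) 1, ((((1 - s) ^ (-(1 / 2) : ℝ) : ℝ)) : ℂ) *
      primBessel (2 * ν) (√x * √s) = ∫ s in Ioo (0 : ℝ) 1, ((((1 - s) ^ (-(1 / 2) : ℝ) : ℝ)) : ℂ) *
      ∑' k : ℕ, (primCoeff (2 * ν) k * (√x : ℂ) ^ (2 * k + 2 * ν + 1)) *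
        (s : ℂ) ^ (k + ν + 1 / 2) :=
    setIntegral_congr_fun measurableSet_Ioo fun s hs => by
      simp only [hs1 s hs]
  rw [hInt, ← H.tsum_eq, ← tsum_mul_left, ← tsum_mul_left]
  refine tsum_congr fun k => ?_
  have hxc : (√x : ℂ) ≠ 0 := by exact_mod_cast (Real.sqrt_pos.2 hx).ne'
  have hx1 : (x : ℂ) ^ (k + ν + 1) = √x * (√x : ℂ) ^ (2 * k + 2 * ν + 1) := by
    rw [show (k + ν + 1 : ℂ) = (2 * k + 2 * ν + 1 + 1) / 2 by ring, ← sqrt_cpow hx,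
      Complex.cpow_add _ _ hxc, Complex.cpow_one, mul_comm]
  have hne : (2 * k + 2 * ν + 1 : ℂ) ≠ 0 := fun h => by
    have := congrArg Complex.re h
    simp [hν] at this
    linarith [(Nat.cast_nonneg k : (0:ℝ) ≤ k)]
  have hne' : (k + ν + 1 / 2 : ℂ) ≠ 0 := fun h => hne (by linear_combination 2 * h)
  rw [sqCoeff, primCoeff, hx1, Complex.Gamma_add_one _ hne',
    show (k + ν + 1 / 2 + 3 / 2 : ℂ) = k + ν + 2 by ring,
    show (k + ν + 1 / 2 : ℂ) = (2 * k + 2 * ν + 1) / 2 by ring]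
  generalize (2 * k + 2 * ν + 1 : ℂ) = q at *
  field_simp

lemma integral_mul_struveL1_eq_tsum (τ : ℝ) {x : ℝ} (hx : 0 < x) :
    ∫ u in Ioi (0 : ℝ), ((√x * Real.cos (τ * u) / Real.cosh (u / 2) : ℝ) : ℂ) *
      struveL1 (2 * I * (√x : ℂ) * (Real.cosh (u / 2) : ℂ)) =
    ((-(√π / Real.cosh (π * τ)) *
      (∑' k, sqCoeff (I * τ) k * (x : ℂ) ^ (k + I * τ + 1)).re : ℝ) : ℂ) := by
  have hν : (I * τ : ℂ).re = 0 := by simp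
  have hμ : (2 * (I * τ) : ℂ).re = 0 := by simp
  rw [integral_mul_struveL1]
  congr 1
  have hI := integral_one_sub_rpow_mul_primBessel hν hx
  have hInt : Integrable (fun s : ℝ => ((((1 - s) ^ (-(1 / 2) : ℝ) : ℝ)) : ℂ) *
      primBessel (2 * (I * τ)) (√x * √s)) (volume.restrict (Ioo 0 1)) := by
    refine Integrable.mul_bdd (c := rexp (4 * √x) *
      ∑' k : ℕ, (1 / 4) ^ k * ‖Complex.Gamma (2 * (I * τ) + 1)‖⁻¹)
      integrableOn_one_sub_rpow_neg_half.ofReal ?_ ?_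
    · have := (continuous_primBessel_abs hμ).comp (show Continuous fun s : ℝ => √x * √s by fun_prop)
      refine (this.congr fun s => ?_).aestronglyMeasurable
      simp only [Function.comp]
      rw [abs_of_nonneg (by positivity)]
    · refine (ae_restrict_iff' measurableSet_Ioo).2 (Filter.Eventually.of_forall fun s hs => ?_)
      refine (norm_primBessel_le hμ (by positivity)).trans ?_
      refine mul_le_mul_of_nonneg_right ?_ (tsum_nonneg fun k => by positivity)
      have : √s ≤ 1 := Real.sqrt_le_one.2 hs.2.le
      have : √x * √s ≤ √x := mul_le_of_le_one_right (Real.sqrt_nonneg x) this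
      gcongr
  have hk : ∀ s ∈ Ioo (0 : ℝ) 1, (1 - s) ^ (-(1 / 2) : ℝ) * cosKernel τ (2 * (√x * √s)) =
      2 * π / Real.cosh (π * τ) * RCLike.re (((((1 - s) ^ (-(1 / 2) : ℝ) : ℝ)) : ℂ) *
        primBessel (2 * (I * τ)) (√x * √s)) := fun s hs => by
    rw [cosKernel_two_mul τ (by positivity), RCLike.re_eq_complex_re, Complex.re_ofReal_mul]
    ring
  rw [setIntegral_congr_fun measurableSet_Ioo hk, integral_const_mul, integral_re hInt,
    RCLike.re_eq_complex_re]
  generalize (∫ s in Ioo (0 : ℝ) 1, ((((1 - s) ^ (-(1 / 2) : ℝ) : ℝ)) : ℂ) *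
      primBessel (2 * (I * τ)) (√x * √s)) = A at *
  generalize (∑' k, sqCoeff (I * τ) k * (x : ℂ) ^ (k + I * τ + 1)) = S at *
  have h2 := congrArg Complex.re hI
  rw [Complex.re_ofReal_mul, mul_assoc, show (2 : ℂ) = ((2 : ℝ) : ℂ) by norm_num,
    Complex.re_ofReal_mul, Complex.re_ofReal_mul] at h2
  have hpi := Real.pi_pos
  field_simp
  linear_combination -h2

lemma norm_Gamma_add_half_mul_le {ν : ℂ} (hν : ν.re = 0) (k : ℕ) :
    ‖Complex.Gamma (k + ν + 1 / 2)‖ * ‖Complex.Gamma (ν + 1)‖ ≤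
      ‖Complex.Gamma (ν + 1 / 2)‖ * ‖Complex.Gamma (k + ν + 1)‖ := by
  induction k with
  | zero => simp
  | succ k ih =>
    have hk : (0 : ℝ) ≤ k := k.cast_nonneg
    have hne : (k : ℂ) + ν + 1 ≠ 0 := fun h => by
      have := congrArg Complex.re h
      simp [hν] at this
      linarith
    have hne' : (k : ℂ) + ν + 1 / 2 ≠ 0 := fun h => by
      have := congrArg Complex.re h
      simp [hν] at this
      linarith
    have hn : ‖(k : ℂ) + ν + 1 / 2‖ ≤ ‖(k : ℂ) + ν + 1‖ := by
      rw [← sq_le_sq₀ (norm_nonneg _) (norm_nonneg _), Complex.sq_norm, Complex.sq_norm,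
        normSq_apply, normSq_apply]
      simp [hν]
      nlinarith
    rw [show (((k + 1 : ℕ) : ℂ) + ν + 1) = (k + ν + 1) + 1 by push_cast; ring,
      show (((k + 1 : ℕ) : ℂ) + ν + 1 / 2) = (k + ν + 1 / 2) + 1 by push_cast; ring,
      Complex.Gamma_add_one _ hne, Complex.Gamma_add_one _ hne', norm_mul, norm_mul]
    calc _ = ‖(k : ℂ) + ν + 1 / 2‖ *
          (‖Complex.Gamma (k + ν + 1 / 2)‖ * ‖Complex.Gamma (ν + 1)‖) := by ring
      _ ≤ ‖(k : ℂ) + ν + 1‖ *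
          (‖Complex.Gamma (ν + 1 / 2)‖ * ‖Complex.Gamma (k + ν + 1)‖) := by gcongr
      _ = _ := by ring

lemma sqCoeff_mul {ν : ℂ} (hν : ν.re = 0) (k : ℕ) :
    sqCoeff ν k * (k + ν + 1) = (-1) ^ k * Complex.Gamma (k + ν + 1 / 2) /
      (k.factorial * Complex.Gamma (k + 2 * ν + 1) * Complex.Gamma (k + ν + 1)) := by
  have hne : (k : ℂ) + ν + 1 ≠ 0 := fun h => by
    have := congrArg Complex.re h
    simp [hν] at this
    linarith [(Nat.cast_nonneg k : (0:ℝ) ≤ k)]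
  rw [sqCoeff, show (k + ν + 2 : ℂ) = k + ν + 1 + 1 by ring, Complex.Gamma_add_one _ hne]
  field_simp

lemma norm_sqCoeff_mul_le {ν : ℂ} (hν : ν.re = 0) (k : ℕ) :
    ‖sqCoeff ν k * (k + ν + 1)‖ ≤ ‖Complex.Gamma (ν + 1 / 2)‖ /
      (‖Complex.Gamma (ν + 1)‖ * ‖Complex.Gamma (2 * ν + 1)‖) / k.factorial := by
  have h1 := norm_Gamma_add_half_mul_le hν k
  have h2 := factorial_mul_norm_Gamma_le (μ := 2 * ν) (by simp [hν]) k
  have h3 : 0 < ‖Complex.Gamma (ν + 1)‖ :=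
    norm_pos_iff.2 (Complex.Gamma_ne_zero_of_re_pos (by simp [hν]))
  have h4 : 0 < ‖Complex.Gamma (2 * ν + 1)‖ :=
    norm_pos_iff.2 (Complex.Gamma_ne_zero_of_re_pos (by simp [hν]))
  have h5 : 0 < ‖Complex.Gamma (k + ν + 1)‖ :=
    norm_pos_iff.2 (Complex.Gamma_ne_zero_of_re_pos (by simp [hν]; positivity))
  have hf : (1 : ℝ) ≤ k.factorial := by exact_mod_cast k.factorial_pos
  have h6 : ‖Complex.Gamma (2 * ν + 1)‖ ≤ ‖Complex.Gamma (k + 2 * ν + 1)‖ :=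
    le_trans (le_mul_of_one_le_left h4.le hf) h2
  rw [sqCoeff_mul hν, norm_div, norm_mul, norm_mul, norm_mul, norm_pow, norm_neg, norm_one, one_pow,
    one_mul, Complex.norm_natCast]
  have h7 : ‖Complex.Gamma (k + ν + 1 / 2)‖ ≤
      ‖Complex.Gamma (ν + 1 / 2)‖ * ‖Complex.Gamma (k + ν + 1)‖ / ‖Complex.Gamma (ν + 1)‖ :=
    (le_div_iff₀ h3).2 h1
  calc _ ≤ ‖Complex.Gamma (ν + 1 / 2)‖ * ‖Complex.Gamma (k + ν + 1)‖ / ‖Complex.Gamma (ν + 1)‖ /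
        (k.factorial * ‖Complex.Gamma (2 * ν + 1)‖ * ‖Complex.Gamma (k + ν + 1)‖) := by gcongr
    _ = _ := by field_simp

lemma norm_sqCoeff_mul_cpow_le {ν : ℂ} (hν : ν.re = 0) (k : ℕ) {x y : ℝ} (hy : 0 < y)
    (hyx : y ≤ x) : ‖sqCoeff ν k * ((k + ν + 1) * (y : ℂ) ^ (k + ν + 1 - 1 : ℂ))‖ ≤
      ‖Complex.Gamma (ν + 1 / 2)‖ / (‖Complex.Gamma (ν + 1)‖ * ‖Complex.Gamma (2 * ν + 1)‖) *
        (x ^ k / k.factorial) := by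
  have h := norm_sqCoeff_mul_le hν k
  rw [← mul_assoc, norm_mul, Complex.norm_cpow_eq_rpow_re_of_pos hy,
    show (k + ν + 1 - 1 : ℂ).re = k by simp [hν], Real.rpow_natCast, ← mul_div_assoc,
    mul_div_right_comm]
  gcongr

lemma hasDerivAt_tsum_sqCoeff {ν : ℂ} (hν : ν.re = 0) {x : ℝ} (hx : 0 < x) :
    HasDerivAt (fun y : ℝ => ∑' k : ℕ, sqCoeff ν k * (y : ℂ) ^ (k + ν + 1))
      (∑' k : ℕ, sqCoeff ν k * ((k + ν + 1) * (x : ℂ) ^ (k + ν + 1 - 1 : ℂ))) x := by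
  have hu := (Real.summable_pow_div_factorial (2 * x)).mul_left
    (‖Complex.Gamma (ν + 1 / 2)‖ / (‖Complex.Gamma (ν + 1)‖ * ‖Complex.Gamma (2 * ν + 1)‖))
  have hne : ∀ k : ℕ, 1 ≤ ‖(k : ℂ) + ν + 1‖ := fun k => by
    refine le_trans ?_ (re_le_norm _)
    simp [hν]
  refine hasDerivAt_tsum_of_isPreconnected (t := Ioo 0 (2 * x)) (y₀ := x) hu isOpen_Ioo
    isPreconnected_Ioo (fun k y hy => ?_)
    (fun k y hy => norm_sqCoeff_mul_cpow_le hν k hy.1 hy.2.le) ⟨hx, by linarith⟩ ?_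
    ⟨hx, by linarith⟩
  · have := hasDerivAt_ofReal_cpow_const hy.1.ne' (r := (k + ν + 1 : ℂ)) fun h => by
      have := hne k
      rw [h, norm_zero] at this
      linarith
    exact this.const_mul _
  · have h0 : Summable fun k : ℕ => sqCoeff ν k * ((k + ν + 1) * (x : ℂ) ^ (k + ν + 1 - 1 : ℂ)) :=
      Summable.of_norm_bounded hu fun k => norm_sqCoeff_mul_cpow_le hν k hx (by linarith)
    refine Summable.of_norm_bounded (h0.norm.mul_left x) fun k => ?_
    have hxc : (x : ℂ) ≠ 0 := by exact_mod_cast hx.ne'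
    rw [Complex.cpow_sub _ _ hxc, Complex.cpow_one, norm_mul, norm_mul, norm_mul, norm_div,
      norm_real, Real.norm_of_nonneg hx.le]
    calc ‖sqCoeff ν k‖ * ‖(x : ℂ) ^ (k + ν + 1)‖ =
          ‖sqCoeff ν k‖ * (1 * ‖(x : ℂ) ^ (k + ν + 1)‖) := by rw [one_mul]
      _ ≤ ‖sqCoeff ν k‖ * (‖(k : ℂ) + ν + 1‖ * ‖(x : ℂ) ^ (k + ν + 1)‖) := by
        gcongr; exact hne k
      _ = _ := by field_simp

lemma Gamma_ratio_eq_choose {ν : ℂ} (hν : ν.re = 0) (i j : ℕ) :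
    Ring.choose (((i + j : ℕ) : ℂ) + ν) j * (j.factorial * Complex.Gamma (i + ν + 1)) =
      Complex.Gamma (((i + j : ℕ) : ℂ) + ν + 1) := by
  have h := Gamma_add_nat_add_one_eq_choose_mul (z := i + ν) (by simp [hν]; positivity) j
  rw [show ((i + j : ℕ) : ℂ) + ν = i + ν + j by push_cast; ring, h]

lemma sum_antidiagonal_inv_Gamma {ν : ℂ} (hν : ν.re = 0) (n : ℕ) :
    ∑ q ∈ Finset.HasAntidiagonal.antidiagonal n,
      (1 / (q.1.factorial * Complex.Gamma (q.1 + ν + 1))) *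
        (1 / (q.2.factorial * Complex.Gamma (q.2 + ν + 1))) =
      Complex.Gamma (2 * n + 2 * ν + 1) /
        (n.factorial * Complex.Gamma (n + 2 * ν + 1) * Complex.Gamma (n + ν + 1) ^ 2) := by
  have hG : ∀ m : ℕ, Complex.Gamma (m + ν + 1) ≠ 0 := fun m =>
    Complex.Gamma_ne_zero_of_re_pos (by simp [hν]; positivity)
  have hG2 : Complex.Gamma (n + 2 * ν + 1) ≠ 0 :=
    Complex.Gamma_ne_zero_of_re_pos (by simp [hν]; positivity)
  have hf : ∀ m : ℕ, (m.factorial : ℂ) ≠ 0 := fun m => by exact_mod_cast m.factorial_ne_zero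
  have hV := Ring.add_choose_eq n (Commute.all ((n : ℂ) + ν) (n + ν))
  have h2 := Gamma_add_nat_add_one_eq_choose_mul (z := n + 2 * ν) (by simp [hν]; positivity) n
  rw [show (2 * n + 2 * ν + 1 : ℂ) = n + 2 * ν + n + 1 by ring, h2,
    show (n + 2 * ν + n : ℂ) = n + ν + (n + ν) by ring, hV, Finset.sum_mul, Finset.sum_div]
  refine Finset.sum_congr rfl fun q hq => ?_
  have hq := Finset.HasAntidiagonal.mem_antidiagonal.1 hq
  have e1 := Gamma_ratio_eq_choose hν q.1 q.2
  have e2 := Gamma_ratio_eq_choose hν q.2 q.1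
  rw [hq] at e1
  rw [add_comm q.2 q.1, hq] at e2
  have g0 := hG n
  have g1 := hG q.1
  have g2 := hG q.2
  have f1 := hf q.1
  have f2 := hf q.2
  have f3 := hf n
  generalize Complex.Gamma (n + 2 * ν + 1) = A at hG2 ⊢
  field_simp
  rw [sq]
  nth_rewrite 1 [← e1]
  rw [← e2]
  ring

lemma summable_norm_besselJ_term {ν : ℂ} (hν : ν.re = 0) {y : ℝ} (hy : 0 < y) :
    Summable fun k : ℕ => ‖((-1 : ℂ) ^ k * (y : ℂ) ^ (2 * (k : ℂ) + ν)) /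
      ((k.factorial : ℂ) * Complex.Gamma ((k : ℂ) + ν + 1))‖ := by
  have hG : 0 < ‖Complex.Gamma (ν + 1)‖ :=
    norm_pos_iff.2 (Complex.Gamma_ne_zero_of_re_pos (by simp [hν]))
  refine Summable.of_nonneg_of_le (fun k => norm_nonneg _) (fun k => ?_)
    ((Real.summable_pow_div_factorial (y ^ 2)).mul_right ‖Complex.Gamma (ν + 1)‖⁻¹)
  have h2 := factorial_mul_norm_Gamma_le hν k
  have hf : (1 : ℝ) ≤ k.factorial := by exact_mod_cast k.factorial_pos
  have h6 : ‖Complex.Gamma (ν + 1)‖ ≤ ‖Complex.Gamma (k + ν + 1)‖ :=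
    le_trans (le_mul_of_one_le_left hG.le hf) h2
  rw [norm_div, norm_mul, norm_mul, norm_pow, norm_neg, norm_one, one_pow, one_mul,
    Complex.norm_natCast, Complex.norm_cpow_eq_rpow_re_of_pos hy,
    show (2 * (k : ℂ) + ν).re = ((2 * k : ℕ) : ℝ) by simp [hν], Real.rpow_natCast, pow_mul,
    ← div_eq_mul_inv, div_div]
  gcongr

lemma besselJ_sqrt_sq {ν : ℂ} (hν : ν.re = 0) {x : ℝ} (hx : 0 < x) :
    √π * besselJ ν (√x : ℂ) ^ 2 =
      ∑' k : ℕ, sqCoeff ν k * ((k + ν + 1) * (x : ℂ) ^ (k + ν + 1 - 1 : ℂ)) := by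
  have hy : 0 < √x / 2 := by positivity
  have hyc : ((√x / 2 : ℝ) : ℂ) ≠ 0 := by exact_mod_cast hy.ne'
  have hs := summable_norm_besselJ_term hν hy
  rw [besselJ, show (√x : ℂ) / 2 = ((√x / 2 : ℝ) : ℂ) by push_cast; rfl, sq,
    tsum_mul_tsum_eq_tsum_sum_antidiagonal_of_summable_norm hs hs, ← tsum_mul_left]
  refine tsum_congr fun n => ?_
  have e1 : ∀ q ∈ Finset.HasAntidiagonal.antidiagonal n,
      ((-1 : ℂ) ^ q.1 * ((√x / 2 : ℝ) : ℂ) ^ (2 * (q.1 : ℂ) + ν)) /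
        ((q.1.factorial : ℂ) * Complex.Gamma ((q.1 : ℂ) + ν + 1)) *
      (((-1 : ℂ) ^ q.2 * ((√x / 2 : ℝ) : ℂ) ^ (2 * (q.2 : ℂ) + ν)) /
        ((q.2.factorial : ℂ) * Complex.Gamma ((q.2 : ℂ) + ν + 1))) =
      ((-1) ^ n * ((√x / 2 : ℝ) : ℂ) ^ (2 * (n + ν) : ℂ)) *
        ((1 / (q.1.factorial * Complex.Gamma (q.1 + ν + 1))) *
          (1 / (q.2.factorial * Complex.Gamma (q.2 + ν + 1)))) := fun q hq => by
    have hq := Finset.HasAntidiagonal.mem_antidiagonal.1 hq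
    rw [← hq, pow_add, show (2 * (((q.1 + q.2 : ℕ) : ℂ) + ν)) = (2 * q.1 + ν) + (2 * q.2 + ν) by
      push_cast; ring, Complex.cpow_add (2 * (q.1 : ℂ) + ν) (2 * (q.2 : ℂ) + ν) hyc]
    generalize ((√x / 2 : ℝ) : ℂ) ^ (2 * (q.1 : ℂ) + ν) = A
    generalize ((√x / 2 : ℝ) : ℂ) ^ (2 * (q.2 : ℂ) + ν) = B
    ring
  rw [Finset.sum_congr rfl e1, ← Finset.mul_sum, sum_antidiagonal_inv_Gamma hν,
    ← mul_assoc (sqCoeff ν n), sqCoeff_mul hν]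
  have h := Complex.Gamma_mul_Gamma_add_half (n + ν + 1 / 2)
  rw [show (n + ν + 1 / 2 + 1 / 2 : ℂ) = n + ν + 1 by ring,
    show (2 * (n + ν + 1 / 2) : ℂ) = 2 * n + 2 * ν + 1 by ring,
    show (1 - (2 * n + 2 * ν + 1) : ℂ) = -(2 * (n + ν)) by ring, Complex.cpow_neg] at h
  have hG : Complex.Gamma (n + ν + 1) ≠ 0 :=
    Complex.Gamma_ne_zero_of_re_pos (by simp [hν]; positivity)
  have hG2 : Complex.Gamma (n + 2 * ν + 1) ≠ 0 :=
    Complex.Gamma_ne_zero_of_re_pos (by simp [hν]; positivity)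
  have hf : (n.factorial : ℂ) ≠ 0 := by exact_mod_cast n.factorial_ne_zero
  have h2 : (2 : ℂ) ^ (2 * (n + ν) : ℂ) ≠ 0 := by simp
  have hx2 : (x : ℂ) ^ (n + ν + 1 - 1 : ℂ) =
      ((√x / 2 : ℝ) : ℂ) ^ (2 * (n + ν) : ℂ) * (2 : ℂ) ^ (2 * (n + ν) : ℂ) := by
    rw [show (2 : ℂ) = ((2 : ℝ) : ℂ) by norm_num, ← Complex.mul_cpow_ofReal_nonneg hy.le (by norm_num),
      ← ofReal_mul, div_mul_cancel₀ _ (by norm_num), sqrt_cpow hx]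
    congr 1; push_cast; ring
  rw [hx2]
  generalize (2 : ℂ) ^ (2 * (n + ν) : ℂ) = T at h h2 ⊢
  generalize ((√x / 2 : ℝ) : ℂ) ^ (2 * (n + ν) : ℂ) = Y
  generalize Complex.Gamma (n + ν + 1) = A at h hG ⊢
  generalize Complex.Gamma (n + 2 * ν + 1) = B at hG2 ⊢
  generalize Complex.Gamma (n + ν + 1 / 2) = C at h ⊢
  generalize Complex.Gamma (2 * n + 2 * ν + 1) = D at h ⊢
  field_simp at h ⊢
  linear_combination (-Y) * h

/-- (Lemma 1) For all `x > 0` and real `τ`, the kernel `Φ_τ(x)` is expressed via the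
Fourier cosine transform:
`Φ_τ(x) = −(1/√π) ∂/∂x ∫_0^∞ (√x cos(τu)/cosh(u/2)) L_1(2i√x cosh(u/2)) du`. -/
theorem Phi_fourier_cosine_rep (x τ : ℝ) (hx : 0 < x) :
    (Phi τ x : ℂ) = -(1 / (Real.sqrt π : ℂ)) *
      deriv (fun x' : ℝ => ∫ u in Set.Ioi (0 : ℝ),
        ((Real.sqrt x' * Real.cos (τ * u) / Real.cosh (u / 2) : ℝ) : ℂ) *
          struveL1 (2 * Complex.I * (Real.sqrt x' : ℂ) * (Real.cosh (u / 2) : ℂ))) x := by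
  have hν : (I * τ : ℂ).re = 0 := by simp
  have h1 := hasDerivAt_tsum_sqCoeff hν hx
  rw [← besselJ_sqrt_sq hν hx] at h1
  have h2 := ((Complex.reCLM.hasFDerivAt.comp_hasDerivAt x h1).const_mul
    (-(√π / Real.cosh (π * τ)))).ofReal_comp
  have h3 := h2.congr_of_eventuallyEq (f₁ := fun x' : ℝ => ∫ u in Set.Ioi (0 : ℝ),
        ((Real.sqrt x' * Real.cos (τ * u) / Real.cosh (u / 2) : ℝ) : ℂ) *
          struveL1 (2 * Complex.I * (Real.sqrt x' : ℂ) * (Real.cosh (u / 2) : ℂ)))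
    ((eventually_gt_nhds hx).mono fun y hy => integral_mul_struveL1_eq_tsum τ hy)
  rw [h3.deriv, Phi, Complex.reCLM_apply, Complex.re_ofReal_mul]
  have hpi : (√π : ℂ) ≠ 0 := by exact_mod_cast (Real.sqrt_pos.2 Real.pi_pos).ne'
  push_cast
  field_simp
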